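/- Let (X,B,T,μ) be an ergodic invertible measure-preserving system on a Lebesgue probability space, Π_μ its Pinsker σ-algebra, and λ = μ⊠_{Π_μ} μ the relatively independent square of μ over Π_μ. Then the product system (X×X, B⊗B, T×T, λ) is ergodic. -/

import Mathlib

open MeasureTheory Filter Topology Set
open scoped symmDiff Classical ENNReal NNReal

section Defs

variable {X : Type*}

/-- The pair `(x, y)` is (positively) asymptotic for `T`. -/
def IsAsymptoticPair [PseudoMetricSpace X] (T : X → X) (x y : X) : Prop :=
  Tendsto (fun n : ℕ => dist (T^[n] x) (T^[n] y)) atTop (𝓝 0)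

/-- Shannon entropy of the finite measurable partition of `X` given by the fibers of a
map `p` into a finite type. -/
noncomputable def partEntropy [MeasurableSpace X] (μ : Measure X) {ι : Type*} [Fintype ι]
    (p : X → ι) : ℝ :=
  ∑ i : ι, Real.negMulLog (μ (p ⁻¹' {i})).toReal

/-- Conditional Shannon entropy `H(P | F)` of the finite partition given by the fibers
of `p` with respect to the sub-σ-algebra `F`:
`H(P|F) = ∑_{A ∈ P} ∫ -E(1_A|F) log E(1_A|F) dμ`. -/
noncomputable def condPartEntropy [MeasurableSpace X] (μ : Measure X)
    (F : MeasurableSpace X) {ι : Type*} [Fintype ι] (p : X → ι) : ℝ :=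
  ∑ i : ι, ∫ x, Real.negMulLog ((μ[(p ⁻¹' {i}).indicator (fun _ => (1 : ℝ)) | F]) x) ∂μ

/-- The σ-algebra `σ(P^-)` generated by the partitions `T^{-n}P`, `n ≥ 1`
(the "past" of the partition given by the fibers of `p`). -/
def partPast (T : X → X) {ι : Type*} (p : X → ι) : MeasurableSpace X :=
  ⨆ n : ℕ, MeasurableSpace.comap (fun x => p (T^[n + 1] x)) ⊤

/-- The σ-algebra `σ(P^T)` generated by the partitions `T^{-n}P`, `n ∈ ℤ`, where `S = T⁻¹`. -/
def partHull (T S : X → X) {ι : Type*} (p : X → ι) : MeasurableSpace X :=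
  ⨆ n : ℕ,
    MeasurableSpace.comap (fun x => p (T^[n] x)) ⊤ ⊔
      MeasurableSpace.comap (fun x => p (S^[n] x)) ⊤

/-- Kolmogorov–Sinai entropy of a finite partition: `h_μ(P, T) = H(P | P^-)`. -/
noncomputable def partKS [MeasurableSpace X] (μ : Measure X) (T : X → X) {ι : Type*}
    [Fintype ι] (p : X → ι) : ℝ :=
  condPartEntropy μ (partPast T p) p

/-- Kolmogorov–Sinai (measure-theoretic) entropy `h_μ(X, T)` of the system:
the supremum over all finite measurable partitions `P` of `h_μ(P, T)`. -/
noncomputable def ksEntropy [MeasurableSpace X] (μ : Measure X) (T : X → X) : ℝ≥0∞ :=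
  ⨆ (k : ℕ) (p : X → Fin k) (_ : Measurable p), ENNReal.ofReal (partKS μ T p)

/-- The Pinsker σ-algebra `Π_μ`: the σ-algebra generated by all finite measurable
partitions with zero Kolmogorov–Sinai entropy. -/
def pinskerAlg [MeasurableSpace X] (μ : Measure X) (T : X → X) : MeasurableSpace X :=
  ⨆ (k : ℕ) (p : X → Fin k) (_ : Measurable p) (_ : partKS μ T p = 0),
    MeasurableSpace.comap p ⊤

/-- Minimal cardinality of a subcover of `⋁_{i=0}^{n-1} T^{-i} C`, where `C` is a
finite cover of `X`. -/
noncomputable def coverNum (T : X → X) {k : ℕ} (C : Fin k → Set X) (n : ℕ) : ℕ :=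
  sInf {m : ℕ | ∃ f : Fin m → Fin n → Fin k,
    (⋃ j : Fin m, ⋂ i : Fin n, T^[(i : ℕ)] ⁻¹' C (f j i)) = Set.univ}

/-- Topological entropy of a finite cover `C`:
`h(C, T) = inf_n (1/n) log N(⋁_{i=0}^{n-1} T^{-i} C) = lim_n (1/n) log N(...)`. -/
noncomputable def coverEntropyOf (T : X → X) {k : ℕ} (C : Fin k → Set X) : ℝ :=
  ⨅ n : ℕ, Real.log (coverNum T C (n + 1)) / (n + 1)

/-- `(x, y)` is a topological entropy pair: `x ≠ y` and every two-set open cover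
`{Uᶜ, Vᶜ}`, where `U` and `V` are disjoint closed neighbourhoods of `x` and `y`,
has positive topological entropy. -/
def IsEntropyPair [TopologicalSpace X] (T : X → X) (x y : X) : Prop :=
  x ≠ y ∧ ∀ U V : Set X, IsClosed U → IsClosed V → U ∈ 𝓝 x → V ∈ 𝓝 y → Disjoint U V →
    0 < coverEntropyOf T ![Uᶜ, Vᶜ]

/-- `(x, y)` is an entropy pair for the invariant measure `μ`: `x ≠ y` and every two-set
Borel partition `(A, Aᶜ)` with `x ∈ interior A` and `y ∈ interior Aᶜ` has positive
entropy with respect to `T` and `μ`. -/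
def IsMuEntropyPair [TopologicalSpace X] [MeasurableSpace X] (T : X → X) (μ : Measure X)
    (x y : X) : Prop :=
  x ≠ y ∧ ∀ A : Set X, MeasurableSet A → x ∈ interior A → y ∈ interior Aᶜ →
    0 < partKS μ T (fun z => if z ∈ A then (0 : Fin 2) else 1)

/-- `ν` is the relatively independent square `μ ⊠_G μ` of `μ` over the sub-σ-algebra `G`:
it is determined by `ν(A × B) = ∫ E(1_A|G) · E(1_B|G) dμ` for all Borel sets `A`, `B`. -/
def IsCondSquare (G : MeasurableSpace X) [m0 : MeasurableSpace X] (μ : Measure X)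
    (ν : Measure (X × X)) : Prop :=
  ∀ A B : Set X, MeasurableSet[m0] A → MeasurableSet[m0] B →
    ν (A ×ˢ B) = ENNReal.ofReal
      (∫ x, (μ[A.indicator (fun _ => (1 : ℝ)) | G]) x *
            (μ[B.indicator (fun _ => (1 : ℝ)) | G]) x ∂μ)

/-- The σ-algebra `m₁` is contained in `m₂` modulo `μ`-null sets. -/
def SubModNull [MeasurableSpace X] (μ : Measure X) (m₁ m₂ : MeasurableSpace X) : Prop :=
  ∀ A : Set X, MeasurableSet[m₁] A → ∃ B : Set X, MeasurableSet[m₂] B ∧ μ (A ∆ B) = 0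

end Defs

section Defs2

variable {X : Type*}

/-- The σ-algebra `F^- = ⋁_{n ≥ 1} T^{-n} F`. -/
def pastAlg (T : X → X) (F : MeasurableSpace X) : MeasurableSpace X :=
  ⨆ n : ℕ, MeasurableSpace.comap (T^[n + 1]) F

/-- The σ-algebra `F^T = ⋁_{n ∈ ℤ} T^{-n} F`, where `S = T⁻¹`. -/
def hullAlg (T S : X → X) (F : MeasurableSpace X) : MeasurableSpace X :=
  ⨆ n : ℕ, MeasurableSpace.comap (T^[n]) F ⊔ MeasurableSpace.comap (S^[n]) F

/-- `P` is (the σ-algebra of) an *excellent* measurable partition for `(X, μ, T)` (here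
`S = T⁻¹`): it is generating (`σ(P^T) = 𝒜` mod `μ`) and it is generated by an increasing
sequence of finite measurable partitions `Pₙ ↑ P` with `H(Pₙ|Pₙ⁻) − H(Pₙ|P⁻) → 0`. -/
def IsExcellentPartition (P : MeasurableSpace X) [m0 : MeasurableSpace X] (μ : Measure X)
    (T S : X → X) : Prop :=
  P ≤ m0 ∧ SubModNull μ m0 (hullAlg T S P) ∧
  ∃ (m : ℕ → ℕ) (Q : ∀ n : ℕ, X → Fin (m n)),
    (∀ n, Measurable (Q n)) ∧
    Monotone (fun n => MeasurableSpace.comap (Q n) (⊤ : MeasurableSpace (Fin (m n)))) ∧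
    (⨆ n : ℕ, MeasurableSpace.comap (Q n) (⊤ : MeasurableSpace (Fin (m n)))) = P ∧
    Tendsto (fun n => condPartEntropy μ (partPast T (Q n)) (Q n) -
      condPartEntropy μ (pastAlg T P) (Q n)) atTop (𝓝 0)

end Defs2

set_option linter.unusedSectionVars false

section EntropyBasics

variable {X : Type*}

/-- The indicator function of a set, real valued. -/
noncomputable abbrev ind (s : Set X) : X → ℝ := s.indicator (fun _ => (1 : ℝ))

/-- The σ-algebra generated by the fibers of `p`. -/
abbrev sg {ι : Type*} (p : X → ι) : MeasurableSpace X := MeasurableSpace.comap p ⊤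

theorem sg_le_iff {ι : Type*} [Countable ι] {p : X → ι} {m : MeasurableSpace X} :
    sg p ≤ m ↔ ∀ i, MeasurableSet[m] (p ⁻¹' {i}) := by
  constructor
  · intro h i
    exact h _ ⟨{i}, trivial, rfl⟩
  · rintro h _ ⟨s, -, rfl⟩
    have : p ⁻¹' s = ⋃ i ∈ s, p ⁻¹' {i} := by ext x; simp
    rw [this]
    exact MeasurableSet.biUnion (Set.to_countable s) (fun i _ => h i)

theorem measurableSet_sg {ι : Type*} (p : X → ι) (i : ι) :
    MeasurableSet[sg p] (p ⁻¹' {i}) := ⟨{i}, trivial, rfl⟩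

theorem sg_pair {ι κ : Type*} [Countable ι] [Countable κ] (p : X → ι) (q : X → κ) :
    sg (fun x => (p x, q x)) = sg p ⊔ sg q := by
  apply le_antisymm
  · rw [sg_le_iff]
    rintro ⟨i, j⟩
    have : (fun x => (p x, q x)) ⁻¹' {(i, j)} = p ⁻¹' {i} ∩ q ⁻¹' {j} := by
      ext x; simp
    rw [this]
    exact MeasurableSet.inter ((le_sup_left : sg p ≤ sg p ⊔ sg q) _ (measurableSet_sg p i))
      ((le_sup_right : sg q ≤ sg p ⊔ sg q) _ (measurableSet_sg q j))
  · refine sup_le ?_ ?_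
    · rintro _ ⟨s, -, rfl⟩
      exact ⟨Prod.fst ⁻¹' s, trivial, rfl⟩
    · rintro _ ⟨s, -, rfl⟩
      exact ⟨Prod.snd ⁻¹' s, trivial, rfl⟩

variable {F F' : MeasurableSpace X} [m0 : MeasurableSpace X] {μ : Measure X} [IsProbabilityMeasure μ]

theorem integrable_ind {s : Set X} (hs : MeasurableSet s) : Integrable (ind s) μ :=
  (integrable_const 1).indicator hs

theorem ce_nonneg (s : Set X) : ∀ᵐ x ∂μ, 0 ≤ (μ[ind s | F]) x :=
  condExp_nonneg (ae_of_all _ fun x => Set.indicator_nonneg (fun _ _ => zero_le_one) x)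

theorem ce_le_one (s : Set X) : ∀ᵐ x ∂μ, (μ[ind s | F]) x ≤ 1 :=
  condExp_le_nonneg_const zero_le_one
    (ae_of_all _ fun x => Set.indicator_le_self' (fun _ _ => zero_le_one) x)

theorem negMulLog_bound {x : ℝ} (h0 : 0 ≤ x) (h1 : x ≤ 1) : ‖Real.negMulLog x‖ ≤ 1 := by
  rw [Real.norm_eq_abs, abs_of_nonneg (Real.negMulLog_nonneg h0 h1)]
  linarith [Real.negMulLog_le_one_sub_self h0]

theorem integrable_nml (hF : F ≤ m0) (s : Set X) :
    Integrable (fun x => Real.negMulLog ((μ[ind s | F]) x)) μ := by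
  refine Integrable.of_bound (C := 1) ?_ ?_
  · exact Real.continuous_negMulLog.comp_aestronglyMeasurable
      (stronglyMeasurable_condExp.mono hF).aestronglyMeasurable
  · filter_upwards [ce_nonneg (μ := μ) (F := F) s, ce_le_one (μ := μ) (F := F) s] with x h0 h1 using negMulLog_bound h0 h1

variable {ι κ : Type*} [Fintype ι] [Fintype κ]

theorem cpe_term_nonneg (s : Set X) :
    0 ≤ ∫ x, Real.negMulLog ((μ[ind s | F]) x) ∂μ := by
  apply integral_nonneg_of_ae
  filter_upwards [ce_nonneg (μ := μ) (F := F) s, ce_le_one (μ := μ) (F := F) s] with x h0 h1 using Real.negMulLog_nonneg h0 h1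

theorem cpe_nonneg (p : X → ι) : 0 ≤ condPartEntropy μ F p :=
  Finset.sum_nonneg fun _ _ => cpe_term_nonneg (μ := μ) (F := F) _

theorem cpe_anti (hF' : F' ≤ m0) (h : F ≤ F') (p : X → ι) :
    condPartEntropy μ F' p ≤ condPartEntropy μ F p := by
  refine Finset.sum_le_sum fun i _ => ?_
  have hF : F ≤ m0 := h.trans hF'
  have hj := ConcaveOn.condExp_map_le (μ := μ) (f := μ[ind (p ⁻¹' {i}) | F']) hF
    Real.concaveOn_negMulLog
    (Real.continuous_negMulLog.upperSemicontinuous.upperSemicontinuousOn _)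
    (ce_nonneg (μ := μ) (F := F') _) isClosed_Ici integrable_condExp (integrable_nml hF' _)
  have htower := condExp_condExp_of_le (μ := μ) (f := ind (p ⁻¹' {i})) h hF'
  calc ∫ x, Real.negMulLog ((μ[ind (p ⁻¹' {i}) | F']) x) ∂μ
      = ∫ x, (μ[Real.negMulLog ∘ μ[ind (p ⁻¹' {i}) | F'] | F]) x ∂μ := (integral_condExp hF).symm
    _ ≤ ∫ x, Real.negMulLog ((μ[ind (p ⁻¹' {i}) | F]) x) ∂μ := by
        apply integral_mono_ae integrable_condExp (integrable_nml hF _)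
        filter_upwards [hj, htower] with x h1 h2
        simpa [h2] using h1

theorem cpe_eq_zero_of_ae {p : X → ι}
    (h : ∀ i, μ[ind (p ⁻¹' {i}) | F] =ᵐ[μ] ind (p ⁻¹' {i})) : condPartEntropy μ F p = 0 := by
  refine Finset.sum_eq_zero fun i _ => ?_
  rw [← integral_zero X ℝ (μ := μ)]
  apply integral_congr_ae
  filter_upwards [h i] with x hx
  rw [hx]
  by_cases hxi : x ∈ p ⁻¹' {i}
  · simp only [ind, Set.indicator_of_mem hxi, Real.negMulLog_one]
  · simp only [ind, Set.indicator_of_notMem hxi, Real.negMulLog_zero]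

theorem cpe_eq_zero_of_le (hF : F ≤ m0) {p : X → ι}
    (h : sg p ≤ F) : condPartEntropy μ F p = 0 := by
  apply cpe_eq_zero_of_ae
  intro i
  rw [condExp_of_stronglyMeasurable hF]
  · exact stronglyMeasurable_const.indicator (sg_le_iff.1 h i)
  · exact integrable_ind (hF _ (sg_le_iff.1 h i))

theorem exists_set_of_cpe_eq_zero (hF : F ≤ m0) {p : X → ι}
    (hp : sg p ≤ m0) (h : condPartEntropy μ F p = 0) (i : ι) :
    ∃ E, MeasurableSet[F] E ∧ ind E =ᵐ[μ] ind (p ⁻¹' {i}) := by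
  have h1 : ∫ x, Real.negMulLog ((μ[ind (p ⁻¹' {i}) | F]) x) ∂μ = 0 :=
    (Finset.sum_eq_zero_iff_of_nonneg (fun i _ => cpe_term_nonneg (μ := μ) (F := F) (p ⁻¹' {i}))).1 h i
      (Finset.mem_univ i)
  rw [integral_eq_zero_iff_of_nonneg_ae ?_ (integrable_nml hF _)] at h1
  swap
  · filter_upwards [ce_nonneg (μ := μ) (F := F) (p ⁻¹' {i}), ce_le_one (μ := μ) (F := F) (p ⁻¹' {i})] with x h0 h1
      using Real.negMulLog_nonneg h0 h1
  set s := p ⁻¹' {i} with hs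
  have hsm : MeasurableSet s := sg_le_iff.1 hp i
  set E : Set X := {x | (μ[ind s | F]) x = 1} with hE
  have hEm : MeasurableSet[F] E :=
    (stronglyMeasurable_condExp.measurable) (measurableSet_singleton 1)
  have hce : μ[ind s | F] =ᵐ[μ] ind E := by
    filter_upwards [h1, ce_nonneg (μ := μ) (F := F) s, ce_le_one (μ := μ) (F := F) s] with x hx h0 h1
    by_cases hxE : x ∈ E
    · simp only [ind, Set.indicator_of_mem hxE]; exact hxE
    · simp only [ind, Set.indicator_of_notMem hxE]
      by_contra hne
      have hlt : (μ[ind s | F]) x < 1 := lt_of_le_of_ne h1 hxE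
      have hpos : 0 < (μ[ind s | F]) x := lt_of_le_of_ne h0 (Ne.symm hne)
      have : 0 < Real.negMulLog ((μ[ind s | F]) x) := by
        unfold Real.negMulLog
        have := Real.log_neg hpos hlt
        nlinarith
      simp only [Pi.zero_apply] at hx
      linarith
  refine ⟨E, hEm, ?_⟩
  have key : ∀ D, MeasurableSet[F] D → μ.real (D ∩ s) = μ.real (D ∩ E) := by
    intro D hD
    have e1 := setIntegral_condExp (μ := μ) hF (integrable_ind hsm) hD
    rw [setIntegral_congr_ae (hF _ hD) (g := ind E) (hce.mono fun x hx _ => hx)] at e1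
    simp only [ind] at e1
    rw [setIntegral_indicator hsm, setIntegral_indicator (hF _ hEm)] at e1
    simp at e1
    exact e1.symm
  have k1 := key E hEm
  have k2 := key Eᶜ (MeasurableSet.compl hEm)
  simp only [Set.inter_self, Set.compl_inter_self, measureReal_empty] at k1 k2
  have n2 : μ (Eᶜ ∩ s) = 0 := (measureReal_eq_zero_iff).1 k2
  have n1 : μ (E \ s) = 0 := by
    have := measureReal_sdiff_add_inter (μ := μ) (s := E) (t := s) hsm
    rw [k1] at this
    exact (measureReal_eq_zero_iff).1 (by linarith)
  have n1' : ∀ᵐ x ∂μ, x ∉ E \ s := measure_eq_zero_iff_ae_notMem.1 n1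
  have n2' : ∀ᵐ x ∂μ, x ∉ Eᶜ ∩ s := measure_eq_zero_iff_ae_notMem.1 n2
  filter_upwards [n1', n2'] with x a b
  by_cases hx : x ∈ E
  · have : x ∈ s := by by_contra h; exact a ⟨hx, h⟩
    simp [ind, hx, this]
  · have : x ∉ s := fun h => b ⟨hx, h⟩
    simp [ind, hx, this]

end EntropyBasics

section EntropyLevy

variable {X : Type*} {ι : Type*} [Fintype ι]

/-- Lévy upward continuity of the conditional entropy. -/
theorem cpe_tendsto {F : ℕ → MeasurableSpace X} [m0 : MeasurableSpace X] {μ : Measure X}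
    [IsProbabilityMeasure μ] (hF : ∀ n, F n ≤ m0) (hmono : Monotone F) (p : X → ι) :
    Tendsto (fun n => condPartEntropy μ (F n) p) atTop (𝓝 (condPartEntropy μ (⨆ n, F n) p)) := by
  refine tendsto_finsetSum _ fun i _ => ?_
  let ℱ : Filtration ℕ m0 := ⟨F, hmono, hF⟩
  refine tendsto_integral_of_dominated_convergence (fun _ => (1 : ℝ)) ?_ (integrable_const _) ?_ ?_
  · intro n
    exact (integrable_nml (hF n) _).aestronglyMeasurable
  · intro n
    filter_upwards [ce_nonneg (μ := μ) (F := F n) (p ⁻¹' {i}),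
      ce_le_one (μ := μ) (F := F n) (p ⁻¹' {i})] with x h0 h1 using negMulLog_bound h0 h1
  · filter_upwards [tendsto_ae_condExp (μ := μ) (ℱ := ℱ) (ind (p ⁻¹' {i}))] with x hx
    exact (Real.continuous_negMulLog.tendsto _).comp hx

end EntropyLevy

section EntropyChain

variable {X : Type*}
variable {F F' : MeasurableSpace X} [m0 : MeasurableSpace X] {μ : Measure X} [IsProbabilityMeasure μ]
variable {ι κ : Type*} [Fintype ι] [Fintype κ]

/-- Conditional expectation commutes with an invertible measure preserving map. -/
theorem condExp_comp_equiv (hF : F ≤ m0) (T : X ≃ᵐ X) (hT : MeasurePreserving T μ μ)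
    {f : X → ℝ} (hf : Integrable f μ) :
    μ[f ∘ T | MeasurableSpace.comap T F] =ᵐ[μ] (μ[f | F]) ∘ T := by
  have hle : MeasurableSpace.comap T F ≤ m0 := by
    rintro _ ⟨s, hs, rfl⟩
    exact T.measurable (hF _ hs)
  symm
  refine ae_eq_condExp_of_forall_setIntegral_eq hle ?_ ?_ ?_ ?_
  · exact (hT.integrable_comp_emb T.measurableEmbedding).2 hf
  · intro s _ _
    exact ((hT.integrable_comp_emb T.measurableEmbedding).2 integrable_condExp).integrableOn
  · rintro _ ⟨s, hs, rfl⟩ _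
    have e1 := hT.setIntegral_preimage_emb T.measurableEmbedding (μ[f | F]) s
    have e2 := hT.setIntegral_preimage_emb T.measurableEmbedding f s
    simp only [Function.comp]
    rw [e1, e2, setIntegral_condExp hF hf hs]
  · apply StronglyMeasurable.aestronglyMeasurable
    have : Measurable[MeasurableSpace.comap T F] ((μ[f | F]) ∘ T) :=
      (stronglyMeasurable_condExp.measurable).comp (comap_measurable _)
    exact this.stronglyMeasurable

theorem cpe_comp (hF : F ≤ m0) (T : X ≃ᵐ X) (hT : MeasurePreserving T μ μ)
    {p : X → ι} (hp : sg p ≤ m0) :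
    condPartEntropy μ (MeasurableSpace.comap T F) (fun x => p (T x)) = condPartEntropy μ F p := by
  refine Finset.sum_congr rfl fun i _ => ?_
  have hs : MeasurableSet (p ⁻¹' {i}) := sg_le_iff.1 hp i
  have e := condExp_comp_equiv hF T hT (integrable_ind (μ := μ) hs)
  have e0 : ind (p ⁻¹' {i}) ∘ T = ind ((fun x => p (T x)) ⁻¹' {i}) := by
    ext x; simp [ind, Set.indicator]
  rw [e0] at e
  rw [← hT.integral_comp T.measurableEmbedding
    (fun x => Real.negMulLog ((μ[ind (p ⁻¹' {i}) | F]) x))]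
  apply integral_congr_ae
  filter_upwards [e] with x hx
  rw [hx]; rfl

theorem cpe_equiv (e : ι ≃ κ) (p : X → ι) :
    condPartEntropy μ F (fun x => e (p x)) = condPartEntropy μ F p := by
  unfold condPartEntropy
  rw [← e.sum_comp]
  refine Finset.sum_congr rfl fun i _ => ?_
  have : (fun x => e (p x)) ⁻¹' {e i} = p ⁻¹' {i} := by ext x; simp
  rw [this]

theorem sup_sg_repr {p : X → ι} {S : Set X} (hS : MeasurableSet[F ⊔ sg p] S) (i : ι) :
    ∃ S', MeasurableSet[F] S' ∧ S ∩ p ⁻¹' {i} = S' ∩ p ⁻¹' {i} := by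
  let M : MeasurableSpace X :=
    { MeasurableSet' := fun S => ∃ S', MeasurableSet[F] S' ∧ S ∩ p ⁻¹' {i} = S' ∩ p ⁻¹' {i}
      measurableSet_empty := ⟨∅, F.measurableSet_empty, rfl⟩
      measurableSet_compl := by
        rintro S ⟨S', h1, h2⟩
        refine ⟨S'ᶜ, MeasurableSet.compl h1, ?_⟩
        ext x
        have := Set.ext_iff.1 h2 x
        simp only [Set.mem_inter_iff, Set.mem_compl_iff] at this ⊢
        tauto
      measurableSet_iUnion := by
        intro S hS
        choose S' h1 h2 using hS
        refine ⟨⋃ n, S' n, MeasurableSet.iUnion h1, ?_⟩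
        rw [Set.iUnion_inter, Set.iUnion_inter]
        exact Set.iUnion_congr h2 }
  have hle : F ⊔ sg p ≤ M := by
    refine sup_le ?_ ?_
    · intro s hs
      exact ⟨s, hs, rfl⟩
    · rw [sg_le_iff]
      intro j
      by_cases hij : j = i
      · subst hij
        exact ⟨Set.univ, MeasurableSet.univ, by simp⟩
      · refine ⟨∅, F.measurableSet_empty, ?_⟩
        ext x
        simp
        intro h h'; exact hij (h.symm.trans h')
  exact hle _ hS

theorem ind_mul_ind (s t : Set X) : ind s * ind t = ind (s ∩ t) := by
  ext x
  by_cases h1 : x ∈ s <;> by_cases h2 : x ∈ t <;> simp [ind, h1, h2]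

theorem integrable_ce_mul_ind {s t : Set X} (hs : MeasurableSet s) :
    Integrable (μ[ind t | F] * ind s) μ := by
  have : μ[ind t | F] * ind s = s.indicator (μ[ind t | F]) := by
    ext x; by_cases h : x ∈ s <;> simp [ind, h]
  rw [this]
  exact integrable_condExp.indicator hs

/-- The basic identity behind the chain rule. -/
theorem chain_key (hF : F ≤ m0) {p : X → ι} (hp : sg p ≤ m0) {C : Set X} (hC : MeasurableSet C)
    (i : ι) :
    ∀ᵐ x ∂μ, x ∈ p ⁻¹' {i} →
      (μ[ind (p ⁻¹' {i}) | F]) x * (μ[ind C | F ⊔ sg p]) x = (μ[ind (p ⁻¹' {i} ∩ C) | F]) x := by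
  set B := p ⁻¹' {i} with hB
  have hBm : MeasurableSet B := sg_le_iff.1 hp i
  have hBs : MeasurableSet[F ⊔ sg p] B := (le_sup_right : sg p ≤ F ⊔ sg p) _ (measurableSet_sg p i)
  have hG : F ⊔ sg p ≤ m0 := sup_le hF hp
  set a := μ[ind B | F] with ha
  set c := μ[ind (B ∩ C) | F] with hc
  have haF : StronglyMeasurable[F] a := stronglyMeasurable_condExp
  have hcF : StronglyMeasurable[F] c := stronglyMeasurable_condExp
  have haG : StronglyMeasurable[F ⊔ sg p] a := haF.mono le_sup_left
  have hcG : StronglyMeasurable[F ⊔ sg p] c := hcF.mono le_sup_left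
  have hint1 : Integrable (a * ind (B ∩ C)) μ := integrable_ce_mul_ind (hBm.inter hC)
  have hint2 : Integrable (c * ind B) μ := integrable_ce_mul_ind hBm
  have pull1 : μ[a * ind (B ∩ C) | F] =ᵐ[μ] a * c :=
    condExp_mul_of_stronglyMeasurable_left haF hint1 (integrable_ind (hBm.inter hC))
  have pull2 : μ[c * ind B | F] =ᵐ[μ] c * a :=
    condExp_mul_of_stronglyMeasurable_left hcF hint2 (integrable_ind hBm)
  have huniq : c * ind B =ᵐ[μ] μ[a * ind (B ∩ C) | F ⊔ sg p] := by
    refine ae_eq_condExp_of_forall_setIntegral_eq hG hint1 (fun _ _ _ => hint2.integrableOn) ?_ ?_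
    · intro S hS _
      obtain ⟨S', hS', hSS⟩ := sup_sg_repr hS i
      have hSm := hG _ hS
      have hSm' := hF _ hS'
      have r : ∀ (f : X → ℝ) (D : Set X), D ⊆ B → MeasurableSet D →
          ∫ x in S, (f * ind D) x ∂μ = ∫ x in S', (f * ind D) x ∂μ := by
        intro f D hD hDm
        have e : f * ind D = D.indicator f := by
          ext x; by_cases h : x ∈ D <;> simp [ind, h]
        rw [e, setIntegral_indicator hDm, setIntegral_indicator hDm]
        have : S ∩ D = S' ∩ D := by
          rw [← Set.inter_eq_self_of_subset_right hD, ← Set.inter_assoc, ← Set.inter_assoc]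
          rw [hSS]
        rw [this]
      rw [r c B subset_rfl hBm, r a (B ∩ C) Set.inter_subset_left (hBm.inter hC)]
      rw [← setIntegral_condExp hF hint2 hS', ← setIntegral_condExp hF hint1 hS']
      apply setIntegral_congr_ae hSm'
      filter_upwards [pull1, pull2] with x h1 h2 _
      rw [h1, h2, mul_comm]
    · apply StronglyMeasurable.aestronglyMeasurable
      exact hcG.mul (stronglyMeasurable_const.indicator hBs)
  have pull3 : μ[(a * ind B) * ind C | F ⊔ sg p] =ᵐ[μ] (a * ind B) * μ[ind C | F ⊔ sg p] := by
    refine condExp_mul_of_stronglyMeasurable_left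
      (haG.mul (stronglyMeasurable_const.indicator hBs)) ?_ (integrable_ind hC)
    rw [mul_assoc, ind_mul_ind]; exact hint1
  rw [mul_assoc, ind_mul_ind] at pull3
  filter_upwards [huniq, pull3] with x h1 h2 hx
  rw [h2] at h1
  simp only [Pi.mul_apply, ind, Set.indicator_of_mem hx, mul_one] at h1
  exact h1.symm

theorem ce_pos_on (hF : F ≤ m0) {B : Set X} (hB : MeasurableSet B) :
    ∀ᵐ x ∂μ, x ∈ B → 0 < (μ[ind B | F]) x := by
  set E : Set X := {x | (μ[ind B | F]) x = 0} with hE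
  have hEm : MeasurableSet[F] E :=
    (stronglyMeasurable_condExp.measurable) (measurableSet_singleton 0)
  have e1 := setIntegral_condExp (μ := μ) hF (integrable_ind hB) hEm
  rw [setIntegral_congr_fun (g := fun _ => (0 : ℝ)) (hF _ hEm) (fun x hx => hx)] at e1
  simp only [ind] at e1
  rw [setIntegral_indicator hB] at e1
  simp at e1
  have n : μ (E ∩ B) = 0 := (measureReal_eq_zero_iff).1 e1.symm
  filter_upwards [measure_eq_zero_iff_ae_notMem.1 n, ce_nonneg (μ := μ) (F := F) B] with x h1 h2 hx
  exact lt_of_le_of_ne h2 (fun h => h1 ⟨h.symm, hx⟩)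

theorem sum_ind (q : X → κ) (x : X) : ∑ j, ind (q ⁻¹' {j}) x = 1 := by
  simp [ind, Set.indicator]

theorem sum_ce (hF : F ≤ m0) {q : X → κ} (hq : sg q ≤ m0) :
    ∀ᵐ x ∂μ, ∑ j, (μ[ind (q ⁻¹' {j}) | F]) x = 1 := by
  have h := condExp_finsetSum (μ := μ) (s := Finset.univ) (f := fun j => ind (q ⁻¹' {j}))
    (fun j _ => integrable_ind (sg_le_iff.1 hq j)) F
  have e : (∑ j, ind (q ⁻¹' {j})) = fun _ => (1 : ℝ) := by
    ext x; rw [Finset.sum_apply, sum_ind]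
  rw [e, condExp_const hF] at h
  filter_upwards [h] with x hx
  rw [Finset.sum_apply] at hx
  exact hx.symm

/-- Chain rule. -/
theorem cpe_chain (hF : F ≤ m0) {p : X → ι} {q : X → κ} (hp : sg p ≤ m0) (hq : sg q ≤ m0) :
    condPartEntropy μ F (fun x => (p x, q x)) =
      condPartEntropy μ F p + condPartEntropy μ (F ⊔ sg p) q := by
  have hG : F ⊔ sg p ≤ m0 := sup_le hF hp
  have hBm : ∀ i, MeasurableSet (p ⁻¹' {i}) := sg_le_iff.1 hp
  have hCm : ∀ j, MeasurableSet (q ⁻¹' {j}) := sg_le_iff.1 hq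
  set a := fun i => μ[ind (p ⁻¹' {i}) | F] with ha
  set b := fun j => μ[ind (q ⁻¹' {j}) | F ⊔ sg p] with hb
  set c := fun i j => μ[ind (p ⁻¹' {i} ∩ q ⁻¹' {j}) | F] with hc
  have hcint : ∀ i j, Integrable (fun x => Real.negMulLog (c i j x)) μ := fun i j =>
    integrable_nml hF _
  have haint : ∀ i, Integrable (fun x => Real.negMulLog (a i x)) μ := fun i => integrable_nml hF _
  have hbint : ∀ j, Integrable (fun x => Real.negMulLog (b j x)) μ := fun j => integrable_nml hG _
  have step : ∀ i, ∫ x, (∑ j, Real.negMulLog (b j x)) * ind (p ⁻¹' {i}) x ∂μ =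
      ∫ x, ((∑ j, Real.negMulLog (c i j x)) - Real.negMulLog (a i x)) ∂μ := by
    intro i
    set φ : X → ℝ := fun x => (∑ j, Real.negMulLog (c i j x)) / a i x + Real.log (a i x) with hφ
    have hφm : StronglyMeasurable[F] φ := by
      apply Measurable.stronglyMeasurable
      have h1 : ∀ j, Measurable[F] (c i j) := fun j => stronglyMeasurable_condExp.measurable
      have h2 : Measurable[F] (a i) := stronglyMeasurable_condExp.measurable
      refine Measurable.add (Measurable.div (Finset.measurable_fun_sum _ fun j _ => ?_) h2)
        (Real.measurable_log.comp h2)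
      exact Real.continuous_negMulLog.measurable.comp (h1 j)
    have e1 : (fun x => (∑ j, Real.negMulLog (b j x)) * ind (p ⁻¹' {i}) x) =ᵐ[μ]
        φ * ind (p ⁻¹' {i}) := by
      have hk : ∀ᵐ x ∂μ, ∀ j, x ∈ p ⁻¹' {i} → a i x * b j x = c i j x :=
        ae_all_iff.2 fun j => chain_key hF hp (hCm j) i
      filter_upwards [hk, ce_pos_on (μ := μ) hF (hBm i), sum_ce (μ := μ) hG hq] with x h1 h2 h3
      by_cases hx : x ∈ p ⁻¹' {i}
      · have hpos : 0 < a i x := h2 hx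
        simp only [Pi.mul_apply, ind, Set.indicator_of_mem hx, mul_one, hφ]
        have : ∀ j, Real.negMulLog (c i j x) =
            b j x * Real.negMulLog (a i x) + a i x * Real.negMulLog (b j x) := by
          intro j; rw [← h1 j hx, Real.negMulLog_mul]
        simp only [this, Finset.sum_add_distrib, ← Finset.sum_mul, ← Finset.mul_sum]
        have h3' : ∑ j, b j x = 1 := h3
        rw [h3']
        unfold Real.negMulLog
        field_simp
        ring
      · simp only [Pi.mul_apply, ind, Set.indicator_of_notMem hx, mul_zero]
    have hint : Integrable (φ * ind (p ⁻¹' {i})) μ := by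
      refine Integrable.congr ?_ e1
      have := (integrable_finsetSum Finset.univ fun j _ => hbint j).indicator (hBm i)
      refine this.congr (ae_of_all _ fun x => ?_)
      by_cases hx : x ∈ p ⁻¹' {i} <;> simp [ind, hx]
    rw [integral_congr_ae e1, ← integral_condExp hF]
    apply integral_congr_ae
    have hle : ∀ᵐ x ∂μ, ∀ j, c i j x ≤ a i x := ae_all_iff.2 fun j =>
      condExp_mono (integrable_ind ((hBm i).inter (hCm j))) (integrable_ind (hBm i))
        (ae_of_all _ fun x => Set.indicator_le_indicator_of_subset Set.inter_subset_left
          (fun _ => zero_le_one) x)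
    have hge : ∀ᵐ x ∂μ, ∀ j, 0 ≤ c i j x := ae_all_iff.2 fun j => ce_nonneg _
    filter_upwards [condExp_mul_of_stronglyMeasurable_left hφm hint (integrable_ind (hBm i)),
      hle, hge] with x h1 h2 h3
    rw [h1]
    change φ x * a i x = _
    simp only [hφ]
    by_cases h0 : a i x = 0
    · have : ∀ j, c i j x = 0 := fun j => le_antisymm (h0 ▸ h2 j) (h3 j)
      simp [h0, this]
    · unfold Real.negMulLog
      field_simp
      ring
  have t1 : condPartEntropy μ (F ⊔ sg p) q =
      ∑ i, ∫ x, (∑ j, Real.negMulLog (b j x)) * ind (p ⁻¹' {i}) x ∂μ := by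
    unfold condPartEntropy
    rw [← integral_finsetSum _ (fun j _ => hbint j), ← integral_finsetSum]
    · refine integral_congr_ae (ae_of_all _ fun x => ?_)
      simp only [← Finset.mul_sum, sum_ind, mul_one]
    · intro i _
      have := (integrable_finsetSum Finset.univ fun j _ => hbint j).indicator (hBm i)
      refine this.congr (ae_of_all _ fun x => ?_)
      by_cases hx : x ∈ p ⁻¹' {i} <;> simp [ind, hx]
  have t2 : condPartEntropy μ F (fun x => (p x, q x)) =
      ∑ i, ∑ j, ∫ x, Real.negMulLog (c i j x) ∂μ := by
    unfold condPartEntropy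
    rw [Fintype.sum_prod_type]
    refine Finset.sum_congr rfl fun i _ => Finset.sum_congr rfl fun j _ => ?_
    have : (fun x => (p x, q x)) ⁻¹' {(i, j)} = p ⁻¹' {i} ∩ q ⁻¹' {j} := by
      ext x; simp
    rw [this]
  have t3 : condPartEntropy μ F p = ∑ i, ∫ x, Real.negMulLog (a i x) ∂μ := rfl
  rw [t1, t2, t3, ← Finset.sum_add_distrib]
  refine Finset.sum_congr rfl fun i _ => ?_
  rw [step i, integral_sub (integrable_finsetSum _ fun j _ => hcint i j) (haint i),
    integral_finsetSum _ fun j _ => hcint i j]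
  ring

end EntropyChain

section Dyn

variable {X : Type*} {ι κ : Type*} [Fintype ι] [Fintype κ]

/-- The `n`-block name of `x` for the partition given by `p`. -/
def blk (T : X → X) (p : X → ι) (n : ℕ) : X → (Fin n → ι) := fun x i => p (T^[(i : ℕ)] x)

theorem sg_le_partPast (T : X → X) (p : X → ι) (n : ℕ) :
    sg (fun x => p (T^[n + 1] x)) ≤ partPast T p :=
  le_iSup (fun n : ℕ => MeasurableSpace.comap (fun x => p (T^[n + 1] x)) ⊤) n

theorem sg_iterate_le {J : MeasurableSpace X} {T : X → X} (hJ : MeasurableSpace.comap T J = J)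
    {p : X → ι} (hp : sg p ≤ J) (n : ℕ) : sg (fun x => p (T^[n] x)) ≤ J := by
  induction n with
  | zero => exact hp
  | succ n ih =>
    have : sg (fun x => p (T^[n + 1] x)) = MeasurableSpace.comap T (sg (fun x => p (T^[n] x))) := by
      rw [sg, sg, MeasurableSpace.comap_comp]
      rfl
    rw [this, ← hJ]
    exact MeasurableSpace.comap_mono ih

theorem partPast_le {J : MeasurableSpace X} {T : X → X} (hJ : MeasurableSpace.comap T J = J)
    {p : X → ι} (hp : sg p ≤ J) : partPast T p ≤ J :=
  iSup_le fun n => sg_iterate_le hJ hp (n + 1)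

theorem sg_blk_le_iff {J : MeasurableSpace X} {T : X → X} {p : X → ι} {n : ℕ} :
    sg (blk T p n) ≤ J ↔ ∀ i < n, sg (fun x => p (T^[i] x)) ≤ J := by
  constructor
  · intro h i hi
    refine le_trans ?_ h
    rintro _ ⟨s, -, rfl⟩
    exact ⟨(fun f => f ⟨i, hi⟩) ⁻¹' s, trivial, rfl⟩
  · intro h
    rw [sg_le_iff]
    intro f
    have : blk T p n ⁻¹' {f} = ⋂ i : Fin n, (fun x => p (T^[(i : ℕ)] x)) ⁻¹' {f i} := by
      ext x
      simp only [Set.mem_preimage, Set.mem_singleton_iff, Set.mem_iInter]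
      exact funext_iff
    rw [this]
    exact MeasurableSet.iInter fun i => sg_le_iff.1 (h i i.2) (f i)

theorem sg_blk_shift_le {J : MeasurableSpace X} {T : X → X} {p : X → ι} {n : ℕ} :
    sg (fun x => blk T p n (T x)) ≤ J ↔ ∀ i < n, sg (fun x => p (T^[i + 1] x)) ≤ J := by
  have : (fun x => blk T p n (T x)) = blk T (fun x => p (T x)) n := by
    ext x i
    simp only [blk]
    rw [← Function.iterate_succ_apply, Function.iterate_succ_apply']
  rw [this, sg_blk_le_iff]
  simp only [Function.iterate_succ_apply']

theorem iSup_blk (I : MeasurableSpace X) (T : X → X) (p : X → ι) :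
    ⨆ n, (I ⊔ sg (fun x => blk T p n (T x))) = I ⊔ partPast T p := by
  apply le_antisymm
  · refine iSup_le fun n => sup_le_sup_left ?_ _
    rw [sg_blk_shift_le]
    exact fun i _ => sg_le_partPast T p i
  · refine sup_le (le_trans le_sup_left (le_iSup (fun n => I ⊔ sg (fun x => blk T p n (T x))) 0)) (iSup_le fun n => ?_)
    refine le_trans ?_ (le_trans le_sup_right (le_iSup (fun n => I ⊔ sg (fun x => blk T p n (T x))) (n + 1)))
    exact sg_blk_shift_le.1 le_rfl n (Nat.lt_succ_self n)

theorem mono_blk (I : MeasurableSpace X) (T : X → X) (p : X → ι) :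
    Monotone fun n => (I ⊔ sg (fun x => blk T p n (T x))) := by
  intro a b hab
  refine sup_le_sup_left ?_ _
  rw [sg_blk_shift_le]
  intro i hi
  exact sg_blk_shift_le.1 le_rfl i (lt_of_lt_of_le hi hab)

variable {I J : MeasurableSpace X} [m0 : MeasurableSpace X] {μ : Measure X} [IsProbabilityMeasure μ]
variable {T : X ≃ᵐ X}

theorem comap_m0 (T : X ≃ᵐ X) : MeasurableSpace.comap T m0 = m0 := T.measurableEmbedding.comap_eq

theorem partPast_le_m0 {p : X → ι} (hp : sg p ≤ m0) : partPast T p ≤ m0 :=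
  partPast_le (comap_m0 T) hp

theorem sg_blk_le_of_inv {J : MeasurableSpace X} {T : X → X} (hJ : MeasurableSpace.comap T J = J)
    {p : X → ι} (hp : sg p ≤ J) (n : ℕ) : sg (blk T p n) ≤ J :=
  sg_blk_le_iff.2 fun i _ => sg_iterate_le hJ hp i

theorem cpe_blk_succ (hT : MeasurePreserving T μ μ) (hIm : I ≤ m0)
    (hI : MeasurableSpace.comap T I = I) {p : X → ι} (hp : sg p ≤ m0) (n : ℕ) :
    condPartEntropy μ I (blk T p (n + 1)) = condPartEntropy μ I (blk T p n) +
      condPartEntropy μ (I ⊔ sg (fun x => blk T p n (T x))) p := by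
  have hb : sg (blk T p n) ≤ m0 := sg_blk_le_of_inv (comap_m0 T) hp n
  have hb' : sg (fun x => blk T p n (T x)) ≤ m0 := by
    rw [sg_blk_shift_le]
    exact fun i _ => sg_iterate_le (comap_m0 T) hp (i + 1)
  let e : (Fin n → ι) × ι ≃ (Fin (n + 1) → ι) :=
    (Equiv.prodComm _ _).trans (Fin.consEquiv (fun _ => ι))
  have h1 : blk T p (n + 1) = fun x => e (blk T p n (T x), p x) := by
    ext x i
    refine Fin.cases ?_ (fun i => ?_) i
    · simp [e, blk]
    · simp [e, blk]
  rw [h1, cpe_equiv e, cpe_chain hIm hb' hp]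
  congr 1
  rw [← cpe_comp hIm T hT hb, hI]

theorem cpe_blk_ge (hT : MeasurePreserving T μ μ) (hIm : I ≤ m0)
    (hI : MeasurableSpace.comap T I = I) {p : X → ι} (hp : sg p ≤ m0) (n : ℕ) :
    n * condPartEntropy μ (I ⊔ partPast T p) p ≤ condPartEntropy μ I (blk T p n) := by
  induction n with
  | zero => simpa using cpe_nonneg _
  | succ n ih =>
    rw [cpe_blk_succ hT hIm hI hp]
    have := cpe_anti (μ := μ) (F := I ⊔ sg (fun x => blk T p n (T x))) (F' := I ⊔ partPast T p)
      (sup_le hIm (partPast_le_m0 hp)) ((iSup_blk I T p) ▸ le_iSup (fun n => I ⊔ sg (fun x => blk T p n (T x))) n) p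
    push_cast
    linarith

theorem cpe_blk_tendsto (hT : MeasurePreserving T μ μ) (hIm : I ≤ m0)
    (hI : MeasurableSpace.comap T I = I) {p : X → ι} (hp : sg p ≤ m0) :
    Tendsto (fun n : ℕ => (n : ℝ)⁻¹ * condPartEntropy μ I (blk T p n)) atTop
      (𝓝 (condPartEntropy μ (I ⊔ partPast T p) p)) := by
  have hb' : ∀ n, I ⊔ sg (fun x => blk T p n (T x)) ≤ m0 := fun n => by
    refine sup_le hIm ?_
    rw [sg_blk_shift_le]
    exact fun i _ => sg_iterate_le (comap_m0 T) hp (i + 1)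
  have h1 := cpe_tendsto (μ := μ) hb' (mono_blk I T p) p
  rw [iSup_blk] at h1
  have h2 := h1.cesaro
  have h3 : ∀ n, condPartEntropy μ I (blk T p n) = condPartEntropy μ I (blk T p 0) +
      ∑ i ∈ Finset.range n, condPartEntropy μ (I ⊔ sg (fun x => blk T p i (T x))) p := by
    intro n
    induction n with
    | zero => simp
    | succ n ih => rw [cpe_blk_succ hT hIm hI hp, ih, Finset.sum_range_succ, add_assoc]
  have h4 : Tendsto (fun n : ℕ => (n : ℝ)⁻¹ * condPartEntropy μ I (blk T p 0)) atTop (𝓝 0) := by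
    simpa using (tendsto_inv_atTop_nhds_zero_nat (𝕜 := ℝ)).mul_const
      (condPartEntropy μ I (blk T p 0))
  have h5 := h4.add h2
  rw [zero_add] at h5
  refine h5.congr fun n => ?_
  rw [h3 n]; ring

theorem entropy_pair_ge (hT : MeasurePreserving T μ μ) (hJm : J ≤ m0)
    (hI : MeasurableSpace.comap T I = I) (hJ : MeasurableSpace.comap T J = J) (hIJ : I ≤ J)
    {p : X → ι} {q : X → κ} (hp : sg p ≤ m0) (hq : sg q ≤ J) :
    condPartEntropy μ (I ⊔ partPast T q) q + condPartEntropy μ (J ⊔ partPast T p) p ≤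
      condPartEntropy μ (I ⊔ partPast T (fun x => (q x, p x))) (fun x => (q x, p x)) := by
  have hIm : I ≤ m0 := hIJ.trans hJm
  have hqm : sg q ≤ m0 := hq.trans hJm
  have hpq : sg (fun x => (q x, p x)) ≤ m0 := by
    rw [sg_pair]; exact sup_le hqm hp
  have hlim := cpe_blk_tendsto hT hIm hI hpq
  refine ge_of_tendsto hlim ?_
  filter_upwards [eventually_gt_atTop 0] with n hn
  have hbp : sg (blk T p n) ≤ m0 := sg_blk_le_of_inv (comap_m0 T) hp n
  have hbq : sg (blk T q n) ≤ J := sg_blk_le_of_inv hJ hq n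
  have e1 : blk T (fun x => (q x, p x)) n =
      fun x => (Equiv.arrowProdEquivProdArrow (Fin n) (fun _ => κ) (fun _ => ι)).symm
        (blk T q n x, blk T p n x) := by
    ext x i <;> rfl
  have e2 := cpe_chain (μ := μ) hIm (hbq.trans hJm) hbp
  have e3 := cpe_blk_ge hT hIm hI hqm n
  have e4 := cpe_blk_ge hT hJm hJ hp n
  have e5 := cpe_anti (μ := μ) hJm (sup_le hIJ hbq) (blk T p n)
  rw [e1, cpe_equiv, e2]
  have hn' : (0 : ℝ) < n := by exact_mod_cast hn
  rw [← div_eq_inv_mul, le_div_iff₀ hn']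
  linarith

end Dyn

section Pinsker

variable {X : Type*} {ι κ : Type*} [Fintype ι] [Fintype κ]

theorem partPast_pair (T : X → X) (p : X → ι) (q : X → κ) :
    partPast T (fun x => (p x, q x)) = partPast T p ⊔ partPast T q := by
  unfold partPast
  rw [← iSup_sup_eq]
  exact iSup_congr fun n => sg_pair (fun x => p (T^[n + 1] x)) (fun x => q (T^[n + 1] x))

theorem sg_le_of_measurable [m0 : MeasurableSpace X] {k : ℕ} {p : X → Fin k} (hp : Measurable p) :
    sg p ≤ m0 := sg_le_iff.2 fun i => hp (measurableSet_singleton i)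

theorem measurable_of_sg_le [m0 : MeasurableSpace X] {k : ℕ} {p : X → Fin k} (hp : sg p ≤ m0) :
    Measurable p := measurable_to_countable' fun i => sg_le_iff.1 hp i

/-- A set in a supremum of σ-algebras belongs to the supremum of a countable subfamily. -/
theorem exists_countable_of_sup (A : MeasurableSpace X) (Z : Set (MeasurableSpace X)) {E : Set X}
    (hE : MeasurableSet[A ⊔ sSup Z] E) :
    ∃ s ⊆ Z, s.Countable ∧ MeasurableSet[A ⊔ sSup s] E := by
  let M : MeasurableSpace X :=
    { MeasurableSet' := fun E => ∃ s ⊆ Z, s.Countable ∧ MeasurableSet[A ⊔ sSup s] E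
      measurableSet_empty := ⟨∅, Set.empty_subset _, Set.countable_empty,
        MeasurableSpace.measurableSet_empty _⟩
      measurableSet_compl := by
        rintro E ⟨s, h1, h2, h3⟩
        exact ⟨s, h1, h2, MeasurableSpace.measurableSet_compl _ _ h3⟩
      measurableSet_iUnion := by
        intro E hE
        choose s h1 h2 h3 using hE
        refine ⟨⋃ n, s n, Set.iUnion_subset h1, Set.countable_iUnion h2,
          MeasurableSpace.measurableSet_iUnion _ _ fun n => ?_⟩
        exact (sup_le_sup_left (sSup_le_sSup (Set.subset_iUnion s n)) A :
          A ⊔ sSup (s n) ≤ A ⊔ sSup (⋃ n, s n)) _ (h3 n) }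
  have hle : A ⊔ sSup Z ≤ M := by
    refine sup_le ?_ (sSup_le fun z hz => ?_)
    · intro t ht
      exact ⟨∅, Set.empty_subset _, Set.countable_empty, (le_sup_left : A ≤ A ⊔ _) _ ht⟩
    · intro t ht
      refine ⟨{z}, by simpa using hz, Set.countable_singleton z, ?_⟩
      exact (le_sup_of_le_right (le_sSup rfl) : z ≤ A ⊔ sSup {z}) _ ht
  exact hle _ hE

variable [m0 : MeasurableSpace X] {μ : Measure X} [IsProbabilityMeasure μ]
variable {T : X ≃ᵐ X}

/-- The σ-algebras of finite zero entropy partitions. -/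
def zeroAlgs (μ : Measure X) (T : X → X) : Set (MeasurableSpace X) :=
  Set.image (fun a : Σ k : ℕ, X → Fin k => sg a.2) {a | Measurable a.2 ∧ partKS μ T a.2 = 0}

theorem pinskerAlg_eq (μ : Measure X) (T : X → X) : pinskerAlg μ T = sSup (zeroAlgs μ T) := by
  apply le_antisymm
  · refine iSup_le fun k => iSup_le fun p => iSup_le fun hp => iSup_le fun h0 => ?_
    exact le_sSup ⟨⟨k, p⟩, ⟨hp, h0⟩, rfl⟩
  · refine sSup_le ?_
    rintro _ ⟨⟨k, p⟩, ⟨hp, h0⟩, rfl⟩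
    exact le_iSup_of_le k (le_iSup_of_le p (le_iSup_of_le hp (le_iSup_of_le h0 le_rfl)))

theorem sg_le_pinsker {k : ℕ} {p : X → Fin k} (hp : Measurable p) (h0 : partKS μ T p = 0) :
    sg p ≤ pinskerAlg μ T := by
  rw [pinskerAlg_eq]
  exact le_sSup ⟨⟨k, p⟩, ⟨hp, h0⟩, rfl⟩

theorem pinskerAlg_le_m0 : pinskerAlg μ T ≤ m0 := by
  rw [pinskerAlg_eq]
  refine sSup_le ?_
  rintro _ ⟨⟨k, p⟩, ⟨hp, h0⟩, rfl⟩
  exact sg_le_of_measurable hp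

theorem partKS_comp (hT : MeasurePreserving T μ μ) {p : X → ι} (hp : sg p ≤ m0) :
    partKS μ T (fun x => p (T x)) = partKS μ T p := by
  have : partPast T (fun x => p (T x)) = MeasurableSpace.comap T (partPast T p) := by
    unfold partPast
    rw [MeasurableSpace.comap_iSup]
    refine iSup_congr fun n => ?_
    rw [MeasurableSpace.comap_comp]
    congr 1
    ext x
    simp only [Function.comp]
    rw [← Function.iterate_succ_apply' T, Function.iterate_succ_apply]
  unfold partKS
  rw [this, cpe_comp (partPast_le_m0 hp) T hT hp]

theorem pinskerAlg_inv (hT : MeasurePreserving T μ μ) :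
    MeasurableSpace.comap T (pinskerAlg μ T) = pinskerAlg μ T := by
  apply le_antisymm
  · rw [MeasurableSpace.comap_le_iff_le_map]
    conv_lhs => rw [pinskerAlg_eq]
    refine sSup_le ?_
    rintro _ ⟨⟨k, p⟩, ⟨hp, h0⟩, rfl⟩
    dsimp only
    rw [← MeasurableSpace.comap_le_iff_le_map, sg, MeasurableSpace.comap_comp]
    refine sg_le_pinsker (hp.comp T.measurable) ?_
    rw [← h0]
    exact partKS_comp hT (sg_le_of_measurable hp)
  · conv_lhs => rw [pinskerAlg_eq]
    refine sSup_le ?_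
    rintro _ ⟨⟨k, p⟩, ⟨hp, h0⟩, rfl⟩
    have e : p = fun x => (p ∘ T.symm) (T x) := by ext x; simp
    have hp' : Measurable (p ∘ T.symm) := hp.comp T.symm.measurable
    have h0' : partKS μ T (p ∘ T.symm) = 0 := by
      rw [← partKS_comp hT (sg_le_of_measurable hp'), ← e, h0]
    have : sg p = MeasurableSpace.comap T (sg (p ∘ T.symm)) := by
      rw [sg, sg, MeasurableSpace.comap_comp]
      congr 1
    dsimp only
    rw [this]
    exact MeasurableSpace.comap_mono (sg_le_pinsker hp' h0')

theorem comap_bot_eq (T : X → X) :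
    MeasurableSpace.comap T (⊥ : MeasurableSpace X) = ⊥ := MeasurableSpace.comap_bot

/-- Pinsker's formula, the inequality we need. -/
theorem partKS_le_of_zero (hT : MeasurePreserving T μ μ) {p : X → ι} {r : X → κ}
    (hp : sg p ≤ m0) (hr : sg r ≤ m0) (h0 : partKS μ T r = 0) :
    partKS μ T p ≤ condPartEntropy μ (partPast T p ⊔ sg r) p := by
  have h1 := entropy_pair_ge (I := ⊥) (J := m0) hT le_rfl (comap_bot_eq T) (comap_m0 T) bot_le hr hp
  simp only [bot_sup_eq] at h1
  have hpast : partPast T (fun x => (p x, r x)) ≤ m0 := by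
    rw [partPast_pair]; exact sup_le (partPast_le_m0 hp) (partPast_le_m0 hr)
  have h2 : condPartEntropy μ (partPast T (fun x => (p x, r x))) (fun x => (p x, r x)) =
      condPartEntropy μ (partPast T (fun x => (p x, r x))) (fun x => (r x, p x)) :=
    (cpe_equiv (Equiv.prodComm ι κ) (fun x => (p x, r x))).symm
  rw [h2, cpe_chain hpast hr hp] at h1
  have h3 : condPartEntropy μ (partPast T (fun x => (p x, r x))) r ≤ 0 := by
    rw [← h0]
    refine cpe_anti hpast ?_ r
    rw [partPast_pair]; exact le_sup_right
  have h4 : condPartEntropy μ (partPast T (fun x => (p x, r x)) ⊔ sg r) p ≤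
      condPartEntropy μ (partPast T p ⊔ sg r) p := by
    refine cpe_anti (sup_le hpast hr) (sup_le_sup_right ?_ _) p
    rw [partPast_pair]; exact le_sup_left
  have h5 := cpe_nonneg (μ := μ) (F := m0 ⊔ partPast T r) r
  unfold partKS
  linarith

theorem zero_pair {p : X → ι} {r : X → κ}
    (hp : sg p ≤ m0) (hr : sg r ≤ m0) (hp0 : partKS μ T p = 0) (h0 : partKS μ T r = 0) :
    partKS μ T (fun x => (p x, r x)) = 0 := by
  have hpast : partPast T (fun x => (p x, r x)) ≤ m0 := by
    rw [partPast_pair]; exact sup_le (partPast_le_m0 hp) (partPast_le_m0 hr)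
  refine le_antisymm ?_ (cpe_nonneg _)
  unfold partKS
  rw [cpe_chain hpast hp hr]
  have h1 : condPartEntropy μ (partPast T (fun x => (p x, r x))) p ≤ 0 := by
    rw [← hp0]
    refine cpe_anti hpast ?_ p
    rw [partPast_pair]; exact le_sup_left
  have h2 : condPartEntropy μ (partPast T (fun x => (p x, r x)) ⊔ sg p) r ≤ 0 := by
    rw [← h0]
    refine cpe_anti (sup_le hpast hp) ?_ r
    rw [partPast_pair]; exact le_sup_of_le_left le_sup_right
  linarith

theorem zero_const (c : ι) : partKS μ T (fun _ => c) = 0 := by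
  have hb : sg (fun _ : X => c) = ⊥ := by
    apply le_bot_iff.1
    rw [sg_le_iff]
    intro i
    by_cases h : c = i
    · have : (fun _ : X => c) ⁻¹' {i} = Set.univ := by ext x; simp [h]
      rw [this]; exact MeasurableSet.univ
    · have : (fun _ : X => c) ⁻¹' {i} = ∅ := by ext x; simp [h]
      rw [this]; exact MeasurableSpace.measurableSet_empty _
  refine cpe_eq_zero_of_le (partPast_le_m0 (hb.trans_le bot_le)) (hb.trans_le bot_le)

theorem exists_join (R : ℕ → MeasurableSpace X) (hR : ∀ n, R n ∈ zeroAlgs μ T) (n : ℕ) :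
    ∃ (κ : Type) (_ : Fintype κ) (r : X → κ), sg r ≤ m0 ∧ partKS μ T r = 0 ∧
      ∀ i < n, R i ≤ sg r := by
  induction n with
  | zero =>
    refine ⟨Unit, inferInstance, fun _ => (), ?_, zero_const _, by simp⟩
    rintro _ ⟨s, -, rfl⟩
    exact measurable_const (MeasurableSpace.measurableSet_top (s := s))
  | succ n ih =>
    obtain ⟨κ, _, r, h1, h2, h3⟩ := ih
    obtain ⟨⟨k, p⟩, ⟨hp, h0⟩, he⟩ := hR n
    have hpm := sg_le_of_measurable hp
    refine ⟨κ × Fin k, inferInstance, fun x => (r x, p x), ?_, zero_pair h1 hpm h2 h0, ?_⟩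
    · rw [sg_pair]; exact sup_le h1 hpm
    · intro i hi
      rw [sg_pair]
      rcases Nat.lt_succ_iff_lt_or_eq.1 hi with h | h
      · exact le_sup_of_le_left (h3 i h)
      · subst h; rw [← he]; exact le_sup_right

theorem partKS_le_of_seq (hT : MeasurePreserving T μ μ) {p : X → ι} (hp : sg p ≤ m0)
    (R : ℕ → MeasurableSpace X) (hR : ∀ n, R n ∈ zeroAlgs μ T) :
    partKS μ T p ≤ condPartEntropy μ (partPast T p ⊔ ⨆ n, R n) p := by
  have hRm : ∀ n, R n ≤ m0 := by
    intro n
    obtain ⟨⟨k, p⟩, ⟨hp, h0⟩, he⟩ := hR n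
    rw [← he]; exact sg_le_of_measurable hp
  have hFm : ∀ n : ℕ, (partPast T p ⊔ ⨆ i, ⨆ (_ : i < n), R i) ≤ m0 := fun n =>
    sup_le (partPast_le_m0 hp) (iSup_le fun i => iSup_le fun _ => hRm i)
  have hFmono : Monotone (fun n : ℕ => partPast T p ⊔ ⨆ i, ⨆ (_ : i < n), R i) := by
    intro a b hab
    refine sup_le_sup_left (iSup_le fun i => iSup_le fun hi => ?_) _
    exact le_iSup_of_le i (le_iSup_of_le (lt_of_lt_of_le hi hab) le_rfl)
  have h1 := cpe_tendsto (μ := μ) hFm hFmono p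
  have e : (⨆ n, (partPast T p ⊔ ⨆ i, ⨆ (_ : i < n), R i)) = partPast T p ⊔ ⨆ n, R n := by
    apply le_antisymm
    · exact iSup_le fun n => sup_le_sup_left (iSup_le fun i => iSup_le fun _ => le_iSup R i) _
    · refine sup_le (le_iSup_of_le 0 le_sup_left) (iSup_le fun n => ?_)
      exact le_iSup_of_le (n + 1) (le_sup_of_le_right
        (le_iSup_of_le n (le_iSup_of_le (Nat.lt_succ_self n) le_rfl)))
  rw [e] at h1
  refine ge_of_tendsto' h1 fun n => ?_
  obtain ⟨κ, _, r, hr, h2, h3⟩ := exists_join R hR n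
  refine (partKS_le_of_zero hT hp hr h2).trans ?_
  exact cpe_anti (sup_le (partPast_le_m0 hp) hr)
    (sup_le_sup_left (iSup_le fun i => iSup_le fun hi => h3 i hi) _) p

theorem partKS_zero_of_rel (hT : MeasurePreserving T μ μ) {p : X → ι} (hp : sg p ≤ m0)
    (h : condPartEntropy μ (pinskerAlg μ T ⊔ partPast T p) p = 0) : partKS μ T p = 0 := by
  rw [sup_comm] at h
  have hG : partPast T p ⊔ pinskerAlg μ T ≤ m0 := sup_le (partPast_le_m0 hp) pinskerAlg_le_m0
  choose E hE hEp using exists_set_of_cpe_eq_zero hG hp h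
  rw [pinskerAlg_eq] at hE
  choose s hsZ hsc hsE using fun i => exists_countable_of_sup _ _ (hE i)
  have hz0 : sg (fun _ : X => (0 : Fin 1)) ∈ zeroAlgs μ T :=
    ⟨⟨1, fun _ => 0⟩, ⟨measurable_const, zero_const _⟩, rfl⟩
  let S : Set (MeasurableSpace X) := insert (sg (fun _ : X => (0 : Fin 1))) (⋃ i, s i)
  have hSc : S.Countable := (Set.countable_iUnion hsc).insert _
  have hSne : S.Nonempty := ⟨_, Set.mem_insert _ _⟩
  obtain ⟨R, hR⟩ := hSc.exists_eq_range hSne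
  have hRZ : ∀ n, R n ∈ zeroAlgs μ T := by
    intro n
    have : R n ∈ S := hR ▸ Set.mem_range_self n
    rcases this with h | h
    · rw [h]; exact hz0
    · obtain ⟨i, hi⟩ := Set.mem_iUnion.1 h
      exact hsZ i hi
  have hle := partKS_le_of_seq hT hp R hRZ
  have hRm : (⨆ n, R n) ≤ m0 := iSup_le fun n => by
    obtain ⟨⟨k, p⟩, ⟨hp, h0⟩, he⟩ := hRZ n
    rw [← he]; exact sg_le_of_measurable hp
  have hGm : partPast T p ⊔ ⨆ n, R n ≤ m0 := sup_le (partPast_le_m0 hp) hRm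
  have hEm : ∀ i, MeasurableSet[partPast T p ⊔ ⨆ n, R n] (E i) := by
    intro i
    refine (sup_le_sup_left ?_ _ : partPast T p ⊔ sSup (s i) ≤ partPast T p ⊔ ⨆ n, R n) _ (hsE i)
    rw [← sSup_range, ← hR]
    exact sSup_le_sSup ((Set.subset_iUnion s i).trans (Set.subset_insert _ _))
  refine le_antisymm (hle.trans (le_of_eq ?_)) (cpe_nonneg _)
  apply cpe_eq_zero_of_ae
  intro i
  refine (condExp_congr_ae (hEp i).symm).trans (Filter.EventuallyEq.trans ?_ (hEp i))
  rw [condExp_of_stronglyMeasurable hGm]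
  · exact stronglyMeasurable_const.indicator (hEm i)
  · exact integrable_ind (hGm _ (hEm i))

/-- The two-set partition attached to `D`. -/
noncomputable def twoPart (D : Set X) : X → Fin 2 := fun x => if x ∈ D then 0 else 1

theorem twoPart_preimage (D : Set X) : twoPart D ⁻¹' {0} = D := by
  ext x; by_cases h : x ∈ D <;> simp [twoPart, h]

theorem sg_twoPart_le {m : MeasurableSpace X} {D : Set X} (hD : MeasurableSet[m] D) :
    sg (twoPart D) ≤ m := by
  rw [sg_le_iff]
  intro i
  fin_cases i
  · simpa [twoPart_preimage] using hD
  · have : twoPart D ⁻¹' {1} = Dᶜ := by ext x; by_cases h : x ∈ D <;> simp [twoPart, h]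
    have h2 := MeasurableSpace.measurableSet_compl m _ hD
    rw [← this] at h2
    exact h2

theorem measurableSet_pinsker {D : Set X} (hD : MeasurableSet D)
    (h0 : partKS μ T (twoPart D) = 0) : MeasurableSet[pinskerAlg μ T] D := by
  have := sg_le_pinsker (measurable_of_sg_le (sg_twoPart_le hD)) h0
  have h2 := sg_le_iff.1 this 0
  rwa [twoPart_preimage] at h2

theorem pinsker_null {D : Set X} (hD : MeasurableSet D) (h0 : μ D = 0) :
    MeasurableSet[pinskerAlg μ T] D := by
  apply measurableSet_pinsker hD
  have hpm : partPast T (twoPart D) ≤ m0 := partPast_le_m0 (sg_twoPart_le hD)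
  apply cpe_eq_zero_of_ae
  intro i
  have hae : ∀ᵐ x ∂μ, x ∉ D := measure_eq_zero_iff_ae_notMem.1 h0
  have hc : ind (twoPart D ⁻¹' {i}) =ᵐ[μ] fun _ => if i = 0 then (0 : ℝ) else 1 := by
    filter_upwards [hae] with x hx
    fin_cases i <;> simp [ind, Set.indicator, twoPart, hx]
  refine (condExp_congr_ae hc).trans ?_
  rw [condExp_const hpm]
  exact hc.symm

end Pinsker

section Tail

/-- The σ-algebra generated by `P` and the partitions `T^{-k} p`, `k ≥ n`. -/
def tailG {X ι : Type*} (P : MeasurableSpace X) (T : X → X) (p : X → ι) (n : ℕ) :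
    MeasurableSpace X :=
  P ⊔ ⨆ k : ℕ, sg (fun x => p (T^[k + n] x))

variable {X : Type*} {P : MeasurableSpace X} {ι : Type*} [Fintype ι]

theorem tailG_anti (T : X → X) (p : X → ι) : Antitone (tailG P T p) := by
  intro a b hab
  refine sup_le_sup_left (iSup_le fun k => ?_) _
  refine le_iSup_of_le (k + (b - a)) (le_of_eq ?_)
  have : k + b = k + (b - a) + a := by omega
  rw [this]

theorem tailG_one (T : X → X) (p : X → ι) : tailG P T p 1 = P ⊔ partPast T p := rfl

theorem le_tailG (T : X → X) (p : X → ι) (n : ℕ) : P ≤ tailG P T p n := le_sup_left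

theorem sg_le_tailG (T : X → X) (p : X → ι) (n : ℕ) :
    sg (fun x => p (T^[n] x)) ≤ tailG P T p n := by
  refine le_sup_of_le_right (le_iSup_of_le 0 (le_of_eq ?_))
  simp

theorem comap_tailG (T : X → X) (p : X → ι) (hP : MeasurableSpace.comap T P = P) (n : ℕ) :
    MeasurableSpace.comap T (tailG P T p n) = tailG P T p (n + 1) := by
  unfold tailG
  rw [MeasurableSpace.comap_sup, hP, MeasurableSpace.comap_iSup]
  congr 1
  refine iSup_congr fun k => ?_
  unfold sg
  rw [MeasurableSpace.comap_comp]
  rfl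

theorem tail_inv {T S : X → X} (hST : ∀ x, S (T x) = x) (hTS : ∀ x, T (S x) = x) (p : X → ι)
    (hP : MeasurableSpace.comap T P = P) :
    MeasurableSpace.comap T (⨅ n, tailG P T p n) = ⨅ n, tailG P T p n := by
  apply le_antisymm
  · refine le_iInf fun n => ?_
    refine (MeasurableSpace.comap_mono (iInf_le _ n)).trans ?_
    rw [comap_tailG T p hP]
    exact tailG_anti T p (Nat.le_succ n)
  · intro D hD
    rw [MeasurableSpace.measurableSet_iInf] at hD
    refine ⟨S ⁻¹' D, ?_, by ext x; simp [hST]⟩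
    rw [MeasurableSpace.measurableSet_iInf]
    intro n
    have h := hD (n + 1)
    rw [← comap_tailG T p hP] at h
    obtain ⟨E, hE, rfl⟩ := h
    have : S ⁻¹' (T ⁻¹' E) = E := by ext x; simp [hTS]
    rwa [this]

variable [m0 : MeasurableSpace X] {μ : Measure X} [IsProbabilityMeasure μ]
variable {T : X ≃ᵐ X}

theorem tailG_le_m0 {p : X → ι} (hp : sg p ≤ m0) (n : ℕ) : tailG (pinskerAlg μ T) T p n ≤ m0 :=
  sup_le pinskerAlg_le_m0 (iSup_le fun k => sg_iterate_le (J := m0) (comap_m0 T) hp (k + n))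

theorem tail_le_pinsker (hT : MeasurePreserving T μ μ) {p : X → ι} (hp : sg p ≤ m0) :
    (⨅ n, tailG (pinskerAlg μ T) T p n) ≤ pinskerAlg μ T := by
  have hPinv := pinskerAlg_inv hT
  have hJinv := tail_inv (P := pinskerAlg μ T) (T := T) (S := T.symm) (by simp) (by simp) p hPinv
  have hJ1 : (⨅ n, tailG (pinskerAlg μ T) T p n) ≤ pinskerAlg μ T ⊔ partPast T p :=
    (iInf_le _ 1).trans (le_of_eq (tailG_one _ _))
  have hPJ : pinskerAlg μ T ≤ (⨅ n, tailG (pinskerAlg μ T) T p n) :=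
    le_iInf fun n => le_tailG _ _ _
  have hG : pinskerAlg μ T ⊔ partPast T p ≤ m0 := sup_le pinskerAlg_le_m0 (partPast_le_m0 hp)
  have hJm := hJ1.trans hG
  intro D hD
  have hDm := hJm _ hD
  have hq := sg_twoPart_le hD
  have hqm := hq.trans hJm
  refine measurableSet_pinsker hDm (partKS_zero_of_rel hT hqm ?_)
  have h1 := entropy_pair_ge hT hJm hPinv hJinv hPJ hp hq
  have hpq : partPast T (twoPart D) ≤ ⨅ n, tailG (pinskerAlg μ T) T p n := partPast_le hJinv hq
  have e1 : pinskerAlg μ T ⊔ partPast T (fun x => (twoPart D x, p x)) =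
      pinskerAlg μ T ⊔ partPast T p := by
    rw [partPast_pair]
    apply le_antisymm
    · exact sup_le le_sup_left (sup_le (hpq.trans hJ1) le_sup_right)
    · exact sup_le le_sup_left (le_sup_of_le_right le_sup_right)
  have e2 : (⨅ n, tailG (pinskerAlg μ T) T p n) ⊔ partPast T p =
      pinskerAlg μ T ⊔ partPast T p :=
    le_antisymm (sup_le hJ1 le_sup_right) (sup_le_sup_right hPJ _)
  rw [e1, e2, cpe_chain hG hqm hp, sup_eq_left.2 (hq.trans hJ1),
    cpe_eq_zero_of_le hG (hq.trans hJ1)] at h1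
  have h2 := cpe_nonneg (μ := μ) (F := pinskerAlg μ T ⊔ partPast T (twoPart D)) (twoPart D)
  linarith

end Tail

section Reverse

theorem proj_tendsto {H : Type*} [NormedAddCommGroup H] [InnerProductSpace ℝ H] [CompleteSpace H]
    (K : ℕ → Submodule ℝ H) [∀ n, (K n).HasOrthogonalProjection] (L : Submodule ℝ H)
    [L.HasOrthogonalProjection] (hK : Antitone K) (h1 : ∀ n, L ≤ K n) (h2 : ⨅ n, K n ≤ L) (x : H) :
    Tendsto (fun n => (K n).starProjection x) atTop (𝓝 (L.starProjection x)) := by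
  have hm : Monotone (fun n => (K n)ᗮ) := fun a b hab => Submodule.orthogonal_le (hK hab)
  have ht := Submodule.starProjection_tendsto_closure_iSup (fun n => (K n)ᗮ) hm x
  set z := (⨆ i, (K i)ᗮ).topologicalClosure.starProjection x with hz
  have e : ∀ n, (K n).starProjection x = x - (K n)ᗮ.starProjection x := by
    intro n
    rw [Submodule.starProjection_orthogonal_val]
    simp
  have ht2 : Tendsto (fun n => (K n).starProjection x) atTop (𝓝 (x - z)) := by
    simp_rw [e]
    exact tendsto_const_nhds.sub ht
  have hmem : x - z ∈ ⨅ n, K n := by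
    rw [Submodule.mem_iInf]
    intro m
    have hc : IsClosed ((K m : Submodule ℝ H) : Set H) := by
      rw [← Submodule.orthogonal_orthogonal (K m)]
      exact Submodule.isClosed_orthogonal _
    refine hc.mem_of_tendsto ht2 ?_
    filter_upwards [eventually_ge_atTop m] with n hn
    exact hK hn (Submodule.starProjection_apply_mem _ _)
  have : L.starProjection x = x - z := by
    refine Submodule.eq_starProjection_of_mem_of_inner_eq_zero (h2 hmem) ?_
    intro w hw
    have ht3 : Tendsto (fun n => inner ℝ (x - (K n).starProjection x) w) atTop
        (𝓝 (inner ℝ (x - (x - z)) w)) :=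
      (tendsto_const_nhds.sub ht2).inner tendsto_const_nhds
    refine tendsto_nhds_unique ht3 ?_
    refine tendsto_const_nhds.congr fun n => ?_
    exact (Submodule.starProjection_inner_eq_zero x w (h1 n hw)).symm
  rw [this]; exact ht2

variable {X : Type*} {P : MeasurableSpace X} {G : ℕ → MeasurableSpace X}

theorem measurable_limsup_iInf (hG : Antitone G) {g : ℕ → X → ℝ} (hg : ∀ n, Measurable[G n] (g n)) :
    Measurable[⨅ n, G n] (fun x => limsup (fun n => g n x) atTop) := by
  intro s hs
  rw [MeasurableSpace.measurableSet_iInf]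
  intro m
  have : Measurable[G m] (fun x => limsup (fun n => g (n + m) x) atTop) :=
    @Measurable.limsup ℝ X _ _ _ (G m) _ _ _ _
      fun n => (hg (n + m)).mono (hG (Nat.le_add_left m n)) le_rfl
  have e : (fun x => limsup (fun n => g (n + m) x) atTop) =
      (fun x => limsup (fun n => g n x) atTop) := by
    ext x
    exact limsup_nat_add (fun n => g n x) m
  rw [e] at this
  exact this hs

theorem reverse_L1 [m0 : MeasurableSpace X] {μ : Measure X} [IsProbabilityMeasure μ]
    (hG : Antitone G) (hGm : ∀ n, G n ≤ m0) (hPG : ∀ n, P ≤ G n) (hGP : ⨅ n, G n ≤ P)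
    {f : X → ℝ} (hf : MemLp f 2 μ) :
    Tendsto (fun n => ∫ x, |(μ[f|G n]) x - (μ[f|P]) x| ∂μ) atTop (𝓝 0) := by
  have hPm : P ≤ m0 := (hPG 0).trans (hGm 0)
  have : ∀ n, Fact (G n ≤ m0) := fun n => ⟨hGm n⟩
  have : Fact (P ≤ m0) := ⟨hPm⟩
  have hle : ⨅ n, lpMeas ℝ ℝ (G n) 2 μ ≤ lpMeas ℝ ℝ P 2 μ := by
    intro u hu
    rw [Submodule.mem_iInf] at hu
    rw [mem_lpMeas_iff_aestronglyMeasurable]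
    have hu' : ∀ n, AEStronglyMeasurable[G n] u μ := fun n =>
      mem_lpMeas_iff_aestronglyMeasurable.1 (hu n)
    choose g hg hgu using hu'
    have hm := measurable_limsup_iInf hG (fun n => (hg n).measurable)
    refine ⟨_, (hm.mono hGP le_rfl).stronglyMeasurable, ?_⟩
    filter_upwards [ae_all_iff.2 hgu] with x hx
    simp [← hx]
  have ht := proj_tendsto (fun n => lpMeas ℝ ℝ (G n) 2 μ) (lpMeas ℝ ℝ P 2 μ)
    (by
      intro a b hab u hu
      rw [mem_lpMeas_iff_aestronglyMeasurable] at hu ⊢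
      exact hu.mono (hG hab))
    (by
      intro n u hu
      rw [mem_lpMeas_iff_aestronglyMeasurable] at hu ⊢
      exact hu.mono (hPG n)) hle hf.toLp
  have e : ∀ (F : MeasurableSpace X) (hF : F ≤ m0), (condExpL2 ℝ ℝ hF hf.toLp : X → ℝ) =ᵐ[μ] μ[f|F] :=
    fun F hF => hf.condExpL2_ae_eq_condExp hF
  rw [tendsto_iff_norm_sub_tendsto_zero] at ht
  refine squeeze_zero (fun n => integral_nonneg fun x => abs_nonneg _) (fun n => ?_) ht
  have hae : (fun x => (μ[f|G n]) x - (μ[f|P]) x) =ᵐ[μ]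
      (((lpMeas ℝ ℝ (G n) 2 μ).starProjection hf.toLp -
        (lpMeas ℝ ℝ P 2 μ).starProjection hf.toLp : Lp ℝ 2 μ) : X → ℝ) := by
    filter_upwards [e (G n) (hGm n), e P hPm, Lp.coeFn_sub
      ((lpMeas ℝ ℝ (G n) 2 μ).starProjection hf.toLp)
      ((lpMeas ℝ ℝ P 2 μ).starProjection hf.toLp)] with x h1 h2 h3
    rw [h3, ← h1, ← h2]
    rfl
  have hml : MemLp (fun x => (μ[f|G n]) x - (μ[f|P]) x) 2 μ :=
    (memLp_congr_ae hae).2 (Lp.memLp _)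
  rw [Lp.norm_def, ← eLpNorm_congr_ae hae]
  have h4 : ∫ x, |(μ[f|G n]) x - (μ[f|P]) x| ∂μ =
      (eLpNorm (fun x => (μ[f|G n]) x - (μ[f|P]) x) 1 μ).toReal := by
    rw [eLpNorm_one_eq_lintegral_enorm]
    exact integral_norm_eq_lintegral_enorm hml.1
  rw [h4]
  exact ENNReal.toReal_mono hml.eLpNorm_ne_top
    (eLpNorm_le_eLpNorm_of_exponent_le one_le_two hml.1)

end Reverse

section Mixing

variable {X : Type*} {P Q : MeasurableSpace X} [m0 : MeasurableSpace X] {μ : Measure X}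
variable [IsProbabilityMeasure μ] {T : X ≃ᵐ X}

theorem ce_iter (hT : MeasurePreserving T μ μ) (hPm : P ≤ m0)
    (hP : MeasurableSpace.comap T P = P) {B : Set X} (hB : MeasurableSet B) (n : ℕ) :
    μ[ind (T^[n] ⁻¹' B) | P] =ᵐ[μ] (μ[ind B | P]) ∘ T^[n] := by
  induction n with
  | zero => exact Filter.EventuallyEq.rfl
  | succ n ih =>
    have hm : MeasurableSet (T^[n] ⁻¹' B) := (T.measurable.iterate n) hB
    have h := condExp_comp_equiv (F := P) hPm T hT (integrable_ind (μ := μ) hm)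
    rw [hP] at h
    have e : ind (T^[n] ⁻¹' B) ∘ T = ind (T^[n + 1] ⁻¹' B) := rfl
    rw [e] at h
    refine h.trans ?_
    exact hT.quasiMeasurePreserving.ae_eq_comp ih

/-- The key estimate. -/
theorem ce_mul_bound (hPQ : P ≤ Q) (hQ : Q ≤ m0) {A C : Set X} (hA : MeasurableSet A)
    (hC : MeasurableSet[Q] C) :
    ∫ x, |(μ[ind (A ∩ C) | P]) x - (μ[ind A | P]) x * (μ[ind C | P]) x| ∂μ ≤
      ∫ x, |(μ[ind A | Q]) x - (μ[ind A | P]) x| ∂μ := by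
  have hPm := hPQ.trans hQ
  have hCm := hQ _ hC
  have i1 : Integrable (μ[ind A | Q] * ind C) μ := integrable_ce_mul_ind hCm
  have i2 : Integrable (μ[ind A | P] * ind C) μ := integrable_ce_mul_ind hCm
  have h1 : μ[ind (A ∩ C) | Q] =ᵐ[μ] μ[ind A | Q] * ind C := by
    rw [← ind_mul_ind]
    refine condExp_mul_of_stronglyMeasurable_right (stronglyMeasurable_const.indicator hC) ?_
      (integrable_ind hA)
    rw [ind_mul_ind]
    exact integrable_ind (hA.inter hCm)
  have h2 : μ[ind (A ∩ C) | P] =ᵐ[μ] μ[μ[ind A | Q] * ind C | P] :=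
    (condExp_condExp_of_le hPQ hQ).symm.trans (condExp_congr_ae h1)
  have h3 : μ[μ[ind A | P] * ind C | P] =ᵐ[μ] μ[ind A | P] * μ[ind C | P] :=
    condExp_mul_of_stronglyMeasurable_left stronglyMeasurable_condExp i2 (integrable_ind hCm)
  have h4 := condExp_sub i1 i2 P
  calc ∫ x, |(μ[ind (A ∩ C) | P]) x - (μ[ind A | P]) x * (μ[ind C | P]) x| ∂μ
      = ∫ x, |(μ[μ[ind A | Q] * ind C - μ[ind A | P] * ind C | P]) x| ∂μ := by
        apply integral_congr_ae
        filter_upwards [h2, h3, h4] with x a b c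
        simp only [Pi.sub_apply, Pi.mul_apply] at a b c ⊢
        rw [c, ← b, a]
    _ ≤ ∫ x, |(μ[ind A | Q] * ind C - μ[ind A | P] * ind C) x| ∂μ := integral_abs_condExp_le _
    _ ≤ ∫ x, |(μ[ind A | Q]) x - (μ[ind A | P]) x| ∂μ := by
        apply integral_mono (i1.sub i2).abs (integrable_condExp.sub integrable_condExp).abs
        intro x
        by_cases hx : x ∈ C <;> simp [ind, hx]

theorem pinsker_mixing (hT : MeasurePreserving T μ μ) {A B : Set X} (hA : MeasurableSet A)
    (hB : MeasurableSet B) :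
    Tendsto (fun n => ∫ x, |(μ[ind (A ∩ T^[n] ⁻¹' B) | pinskerAlg μ T]) x -
      (μ[ind A | pinskerAlg μ T]) x * (μ[ind B | pinskerAlg μ T]) (T^[n] x)| ∂μ) atTop (𝓝 0) := by
  have hp : sg (twoPart B) ≤ m0 := sg_twoPart_le hB
  have hlim := reverse_L1 (μ := μ) (G := tailG (pinskerAlg μ T) T (twoPart B)) (P := pinskerAlg μ T)
    (tailG_anti T _) (tailG_le_m0 hp) (le_tailG T _) (tail_le_pinsker hT hp)
    (f := ind A) (memLp_indicator_const 2 hA 1 (Or.inr (measure_ne_top _ _)))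
  refine squeeze_zero (fun n => integral_nonneg fun x => abs_nonneg _) (fun n => ?_) hlim
  have hC : MeasurableSet[tailG (pinskerAlg μ T) T (twoPart B) n] (T^[n] ⁻¹' B) := by
    have h := sg_le_iff.1 (sg_le_tailG (P := pinskerAlg μ T) T (twoPart B) n) 0
    have e : (fun x => twoPart B (T^[n] x)) ⁻¹' {0} = T^[n] ⁻¹' B := by
      rw [← twoPart_preimage B, twoPart_preimage B]
      conv_rhs => rw [← twoPart_preimage B]
      rfl
    rwa [e] at h
  refine le_trans (le_of_eq ?_) (ce_mul_bound (le_tailG T (twoPart B) n) (tailG_le_m0 hp n) hA hC)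
  apply integral_congr_ae
  filter_upwards [ce_iter hT pinskerAlg_le_m0 (pinskerAlg_inv hT) hB n] with x hx
  rw [hx]; rfl

end Mixing

section MeanErgodic

/-- Cesàro averages. -/
noncomputable def ces (u : ℕ → ℝ) (N : ℕ) : ℝ := (N : ℝ)⁻¹ * ∑ n ∈ Finset.range N, u n

theorem ces_sub (u v : ℕ → ℝ) (N : ℕ) : ces (fun n => u n - v n) N = ces u N - ces v N := by
  simp [ces, Finset.sum_sub_distrib, mul_sub]

theorem ces_const {c : ℝ} {N : ℕ} (hN : 1 ≤ N) : ces (fun _ => c) N = c := by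
  have : (N : ℝ) ≠ 0 := by positivity
  simp [ces, this]

theorem ces_tendsto {u : ℕ → ℝ} {l : ℝ} (h : Tendsto u atTop (𝓝 l)) :
    Tendsto (ces u) atTop (𝓝 l) := h.cesaro

variable {X : Type*} [m0 : MeasurableSpace X] {μ : Measure X} [IsProbabilityMeasure μ]
variable {T : X → X}

theorem mean_ergodic (hT : Ergodic T μ) {u v : X → ℝ} (hu : MemLp u 2 μ) (hv : MemLp v 2 μ) :
    Tendsto (ces fun n => ∫ x, u x * v (T^[n] x) ∂μ) atTop (𝓝 ((∫ x, u x ∂μ) * ∫ x, v x ∂μ)) := by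
  have hmp := hT.toMeasurePreserving
  let U : Lp ℝ 2 μ →L[ℝ] Lp ℝ 2 μ :=
    (Lp.compMeasurePreservingₗᵢ ℝ T hmp).toContinuousLinearMap
  have hU : ‖U‖ ≤ 1 := LinearIsometry.norm_toContinuousLinearMap_le _
  have ht := U.tendsto_birkhoffAverage_orthogonalProjection hU (hv.toLp v)
  set w : Lp ℝ 2 μ := (((U.eqLocus (1 : Lp ℝ 2 μ →L[ℝ] Lp ℝ 2 μ)).orthogonalProjectionOnto
    (hv.toLp v) : _) : Lp ℝ 2 μ) with hw
  have hinv : U w = w := by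
    have := ((U.eqLocus (1 : Lp ℝ 2 μ →L[ℝ] Lp ℝ 2 μ)).orthogonalProjectionOnto
      (hv.toLp v)).2
    exact this
  have hiter : ∀ n : ℕ, (U^[n] (hv.toLp v)) = (hv.comp_measurePreserving (hmp.iterate n)).toLp _ := by
    intro n
    induction n with
    | zero => rfl
    | succ n ih =>
      rw [Function.iterate_succ_apply', ih]
      rfl
  have key : ∀ {f : X → ℝ} (hf : MemLp f 2 μ),
      Tendsto (ces fun n => ∫ x, f x * v (T^[n] x) ∂μ) atTop (𝓝 (∫ x, f x * w x ∂μ)) := by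
    intro f hf
    have h1 := (tendsto_const_nhds (x := hf.toLp f)).inner (𝕜 := ℝ) ht
    have e1 : inner ℝ (hf.toLp f) w = ∫ x, f x * w x ∂μ := by
      rw [L2.inner_def]
      apply integral_congr_ae
      filter_upwards [hf.coeFn_toLp] with x hx
      rw [hx]; simp [mul_comm]
    rw [e1] at h1
    refine h1.congr fun N => ?_
    rw [birkhoffAverage, birkhoffSum, inner_smul_right, inner_sum]
    unfold ces
    congr 1
    refine Finset.sum_congr rfl fun n _ => ?_
    rw [id, hiter, L2.inner_def]
    apply integral_congr_ae
    filter_upwards [hf.coeFn_toLp, (hv.comp_measurePreserving (hmp.iterate n)).coeFn_toLp] with x hx hy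
    rw [hx, hy]; simp [mul_comm]
  obtain ⟨c, hc⟩ := hT.ae_eq_const_of_ae_eq_comp_ae (Lp.aestronglyMeasurable w) (by
    have := Lp.coeFn_compMeasurePreserving w hmp
    refine this.symm.trans ?_
    have e : Lp.compMeasurePreserving T hmp w = w := hinv
    rw [e])
  have e2 : ∀ f : X → ℝ, ∫ x, f x * w x ∂μ = (∫ x, f x ∂μ) * c := by
    intro f
    rw [← integral_mul_const]
    apply integral_congr_ae
    filter_upwards [hc] with x hx
    rw [hx]; rfl
  have h1 := key (memLp_const (1 : ℝ))
  rw [e2] at h1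
  have e3 : ∀ n : ℕ, ∫ x, 1 * v (T^[n] x) ∂μ = ∫ x, v x ∂μ := by
    intro n
    simp only [one_mul]
    have hm := hmp.iterate n
    rw [← integral_map hm.measurable.aemeasurable (by rw [hm.map_eq]; exact hv.1), hm.map_eq]
  have h2 : Tendsto (ces fun n => ∫ x, 1 * v (T^[n] x) ∂μ) atTop (𝓝 (∫ x, v x ∂μ)) := by
    simp_rw [e3]
    exact ces_tendsto tendsto_const_nhds
  have h3 := tendsto_nhds_unique h1 h2
  simp only [integral_const, probReal_univ, smul_eq_mul, one_mul, mul_one] at h3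
  rw [← h3, ← e2]
  exact key hu

end MeanErgodic

section Final

variable {X : Type*} {P : MeasurableSpace X} [m0 : MeasurableSpace X] {μ : Measure X}
variable [IsProbabilityMeasure μ] {T : X ≃ᵐ X} {lam : Measure (X × X)}

theorem lam_prob (hPm : P ≤ m0) (h : IsCondSquare P μ lam) : IsProbabilityMeasure lam := by
  constructor
  rw [← univ_prod_univ, h _ _ MeasurableSet.univ MeasurableSet.univ]
  have : (Set.univ : Set X).indicator (fun _ => (1 : ℝ)) = fun _ => 1 := by ext; simp
  rw [this, condExp_const hPm]
  simp

theorem lam_real (h : IsCondSquare P μ lam) {A B : Set X} (hA : MeasurableSet A)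
    (hB : MeasurableSet B) :
    lam.real (A ×ˢ B) = ∫ x, (μ[ind A | P]) x * (μ[ind B | P]) x ∂μ := by
  rw [Measure.real, h A B hA hB, ENNReal.toReal_ofReal]
  apply integral_nonneg_of_ae
  filter_upwards [ce_nonneg (μ := μ) (F := P) A, ce_nonneg (μ := μ) (F := P) B] with x a b
  exact mul_nonneg a b

theorem ce_aesm (hPm : P ≤ m0) (A : Set X) : AEStronglyMeasurable (μ[ind A | P]) μ :=
  (stronglyMeasurable_condExp.mono hPm).aestronglyMeasurable

theorem memLp_prod (hPm : P ≤ m0) (A B : Set X) :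
    MemLp (fun x => (μ[ind A | P]) x * (μ[ind B | P]) x) 2 μ := by
  refine MemLp.of_bound ((ce_aesm hPm A).mul (ce_aesm hPm B)) 1 ?_
  filter_upwards [ce_nonneg (μ := μ) (F := P) A, ce_nonneg (μ := μ) (F := P) B,
    ce_le_one (μ := μ) (F := P) A, ce_le_one (μ := μ) (F := P) B] with x a b c d
  rw [Real.norm_of_nonneg (mul_nonneg a b)]
  exact mul_le_one₀ c b d

theorem lam_mp (hT : MeasurePreserving T μ μ) (hPm : P ≤ m0)
    (hP : MeasurableSpace.comap T P = P) (h : IsCondSquare P μ lam) :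
    MeasurePreserving (Prod.map T T) lam lam := by
  have := lam_prob hPm h
  have hm : Measurable (Prod.map T T) := T.measurable.prodMap T.measurable
  refine ⟨hm, ?_⟩
  have := Measure.isProbabilityMeasure_map (μ := lam) hm.aemeasurable
  refine ext_of_generate_finite _ generateFrom_prod.symm isPiSystem_prod ?_ (by simp)
  rintro _ ⟨A, hA, B, hB, rfl⟩
  rw [Measure.map_apply hm (hA.prod hB), Set.preimage_prod_map_prod,
    h _ _ (T.measurable hA) (T.measurable hB), h _ _ hA hB]
  congr 1
  have a := ce_iter hT hPm hP hA 1
  have b := ce_iter hT hPm hP hB 1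
  rw [← hT.integral_comp' (g := fun x => (μ[A.indicator (fun _ => (1 : ℝ)) | P]) x *
            (μ[B.indicator (fun _ => (1 : ℝ)) | P]) x)]
  apply integral_congr_ae
  filter_upwards [a, b] with x ha hb
  simp only [Function.iterate_one, Function.comp] at ha hb
  rw [ha, hb]

theorem abs_mul_sub_le {a b c d : ℝ} (hb0 : 0 ≤ b) (hb : b ≤ 1) (hc0 : 0 ≤ c) (hc : c ≤ 1) :
    |a * b - c * d| ≤ |a - c| + |b - d| := by
  have : a * b - c * d = (a - c) * b + c * (b - d) := by ring
  rw [this]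
  refine (abs_add_le _ _).trans ?_
  rw [abs_mul, abs_mul, abs_of_nonneg hb0, abs_of_nonneg hc0]
  gcongr
  · exact mul_le_of_le_one_right (abs_nonneg _) hb
  · exact mul_le_of_le_one_left (abs_nonneg _) hc

theorem rect_ces (hT : Ergodic T μ) (h : IsCondSquare (pinskerAlg μ T) μ lam) {A₁ B₁ A₂ B₂ : Set X}
    (hA₁ : MeasurableSet A₁) (hB₁ : MeasurableSet B₁) (hA₂ : MeasurableSet A₂)
    (hB₂ : MeasurableSet B₂) :
    Tendsto (ces fun n => lam.real ((A₁ ×ˢ B₁) ∩ (Prod.map T T)^[n] ⁻¹' (A₂ ×ˢ B₂))) atTop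
      (𝓝 (lam.real (A₁ ×ˢ B₁) * lam.real (A₂ ×ˢ B₂))) := by
  have hmp := hT.toMeasurePreserving
  have hPm : pinskerAlg μ T ≤ m0 := pinskerAlg_le_m0
  have hme := mean_ergodic hT (memLp_prod hPm A₁ B₁) (memLp_prod hPm A₂ B₂)
  rw [lam_real h hA₁ hB₁, lam_real h hA₂ hB₂]
  have hA := pinsker_mixing hmp hA₁ hA₂
  have hB := pinsker_mixing hmp hB₁ hB₂
  have hAB := hA.add hB
  rw [add_zero] at hAB
  have hdiff : Tendsto (fun n => lam.real ((A₁ ×ˢ B₁) ∩ (Prod.map T T)^[n] ⁻¹' (A₂ ×ˢ B₂)) -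
      ∫ x, ((μ[ind A₁ | pinskerAlg μ T]) x * (μ[ind B₁ | pinskerAlg μ T]) x) *
        ((μ[ind A₂ | pinskerAlg μ T]) (T^[n] x) * (μ[ind B₂ | pinskerAlg μ T]) (T^[n] x)) ∂μ)
      atTop (𝓝 0) := by
    refine squeeze_zero_norm (fun n => ?_) hAB
    have hn := hmp.iterate n
    have e : (A₁ ×ˢ B₁) ∩ (Prod.map T T)^[n] ⁻¹' (A₂ ×ˢ B₂) =
        (A₁ ∩ T^[n] ⁻¹' A₂) ×ˢ (B₁ ∩ T^[n] ⁻¹' B₂) := by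
      rw [Prod.map_iterate, Set.preimage_prod_map_prod, Set.prod_inter_prod]
    rw [e, lam_real h (hA₁.inter (hn.measurable hA₂)) (hB₁.inter (hn.measurable hB₂))]
    have hq := hn.quasiMeasurePreserving
    have sA1 := ce_aesm (μ := μ) hPm A₁
    have sB1 := ce_aesm (μ := μ) hPm B₁
    have sA2 := (ce_aesm (μ := μ) hPm A₂).comp_quasiMeasurePreserving hq
    have sB2 := (ce_aesm (μ := μ) hPm B₂).comp_quasiMeasurePreserving hq
    have sA := ce_aesm (μ := μ) hPm (A₁ ∩ T^[n] ⁻¹' A₂)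
    have sB := ce_aesm (μ := μ) hPm (B₁ ∩ T^[n] ⁻¹' B₂)
    have nn := fun s => ce_nonneg (μ := μ) (F := pinskerAlg μ T) s
    have le := fun s => ce_le_one (μ := μ) (F := pinskerAlg μ T) s
    have iA : Integrable (fun x => (μ[ind A₁ | pinskerAlg μ T]) x *
        (μ[ind A₂ | pinskerAlg μ T]) (T^[n] x)) μ := by
      refine Integrable.of_bound (sA1.mul sA2) 1 ?_
      filter_upwards [nn A₁, le A₁, hq.ae (nn A₂), hq.ae (le A₂)] with x a b c d
      rw [Real.norm_of_nonneg (mul_nonneg a c)]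
      exact mul_le_one₀ b c d
    have iB : Integrable (fun x => (μ[ind B₁ | pinskerAlg μ T]) x *
        (μ[ind B₂ | pinskerAlg μ T]) (T^[n] x)) μ := by
      refine Integrable.of_bound (sB1.mul sB2) 1 ?_
      filter_upwards [nn B₁, le B₁, hq.ae (nn B₂), hq.ae (le B₂)] with x a b c d
      rw [Real.norm_of_nonneg (mul_nonneg a c)]
      exact mul_le_one₀ b c d
    have dA : Integrable (fun x => (μ[ind (A₁ ∩ T^[n] ⁻¹' A₂) | pinskerAlg μ T]) x -
        (μ[ind A₁ | pinskerAlg μ T]) x * (μ[ind A₂ | pinskerAlg μ T]) (T^[n] x)) μ :=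
      integrable_condExp.sub iA
    have dB : Integrable (fun x => (μ[ind (B₁ ∩ T^[n] ⁻¹' B₂) | pinskerAlg μ T]) x -
        (μ[ind B₁ | pinskerAlg μ T]) x * (μ[ind B₂ | pinskerAlg μ T]) (T^[n] x)) μ :=
      integrable_condExp.sub iB
    have i1 := (memLp_prod (μ := μ) hPm (A₁ ∩ T^[n] ⁻¹' A₂) (B₁ ∩ T^[n] ⁻¹' B₂)).integrable
      one_le_two
    have i2 : Integrable (fun x =>
        ((μ[ind A₁ | pinskerAlg μ T]) x * (μ[ind B₁ | pinskerAlg μ T]) x) *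
        ((μ[ind A₂ | pinskerAlg μ T]) (T^[n] x) * (μ[ind B₂ | pinskerAlg μ T]) (T^[n] x))) μ := by
      refine Integrable.of_bound ((sA1.mul sB1).mul (sA2.mul sB2)) 1 ?_
      filter_upwards [nn A₁, le A₁, hq.ae (nn A₂), hq.ae (le A₂),
        nn B₁, le B₁, hq.ae (nn B₂), hq.ae (le B₂)] with x a b c d a' b' c' d'
      rw [Real.norm_of_nonneg (mul_nonneg (mul_nonneg a a') (mul_nonneg c c'))]
      exact mul_le_one₀ (mul_le_one₀ b a' b') (mul_nonneg c c') (mul_le_one₀ d c' d')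
    rw [← integral_sub i1 i2, ← integral_add dA.abs dB.abs]
    refine (norm_integral_le_integral_norm _).trans ?_
    refine integral_mono_ae (i1.sub i2).norm (dA.abs.add dB.abs) ?_
    filter_upwards [nn A₁, le A₁, hq.ae (nn A₂), hq.ae (le A₂),
      nn (B₁ ∩ T^[n] ⁻¹' B₂), le (B₁ ∩ T^[n] ⁻¹' B₂)] with x a b c d e f
    rw [Real.norm_eq_abs]
    refine le_trans (le_of_eq ?_) (abs_mul_sub_le e f (mul_nonneg a c) (mul_le_one₀ b c d))
    congr 1
    ring
  have h1 := (ces_tendsto hdiff).add hme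
  rw [zero_add] at h1
  refine h1.congr fun N => ?_
  rw [ces_sub]
  ring

theorem all_ces (hT : Ergodic T μ) (h : IsCondSquare (pinskerAlg μ T) μ lam) {A₂ B₂ : Set X}
    (hA₂ : MeasurableSet A₂) (hB₂ : MeasurableSet B₂) {E : Set (X × X)} (hE : MeasurableSet E) :
    Tendsto (ces fun n => lam.real (E ∩ (Prod.map T T)^[n] ⁻¹' (A₂ ×ˢ B₂))) atTop
      (𝓝 (lam.real E * lam.real (A₂ ×ˢ B₂))) := by
  have hmp := hT.toMeasurePreserving
  have hPm : pinskerAlg μ T ≤ m0 := pinskerAlg_le_m0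
  have hprob := lam_prob hPm h
  have hS := lam_mp hmp hPm (pinskerAlg_inv hmp) h
  have hRm : ∀ n : ℕ, MeasurableSet ((Prod.map T T)^[n] ⁻¹' (A₂ ×ˢ B₂)) := fun n =>
    (hS.iterate n).measurable (hA₂.prod hB₂)
  have hR : ∀ n : ℕ, lam.real ((Prod.map T T)^[n] ⁻¹' (A₂ ×ˢ B₂)) = lam.real (A₂ ×ˢ B₂) := fun n =>
    (hS.iterate n).measureReal_preimage (hA₂.prod hB₂).nullMeasurableSet
  induction E, hE using MeasurableSpace.induction_on_inter generateFrom_prod.symm isPiSystem_prod with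
  | empty =>
    simp only [Set.empty_inter, measureReal_empty, zero_mul]
    exact ces_tendsto tendsto_const_nhds
  | basic t ht =>
    obtain ⟨A₁, hA₁, B₁, hB₁, rfl⟩ := ht
    exact rect_ces hT h hA₁ hB₁ hA₂ hB₂
  | compl t ht ih =>
    have e : ∀ n : ℕ, lam.real (tᶜ ∩ (Prod.map T T)^[n] ⁻¹' (A₂ ×ˢ B₂)) =
        lam.real (A₂ ×ˢ B₂) - lam.real (t ∩ (Prod.map T T)^[n] ⁻¹' (A₂ ×ˢ B₂)) := by
      intro n
      rw [← hR n, Set.inter_comm, Set.inter_comm t]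
      have := measureReal_inter_add_sdiff (μ := lam) (s := (Prod.map T T)^[n] ⁻¹' (A₂ ×ˢ B₂)) ht
      rw [Set.sdiff_eq] at this
      linarith
    simp_rw [e]
    have h1 : Tendsto (ces fun _ => lam.real (A₂ ×ˢ B₂)) atTop (𝓝 (lam.real (A₂ ×ˢ B₂))) :=
      ces_tendsto tendsto_const_nhds
    have h2 := h1.sub ih
    rw [probReal_compl_eq_one_sub ht, sub_mul, one_mul]
    exact h2.congr fun N => (ces_sub _ _ N).symm
  | iUnion f hd hfm ih =>
    have hsum : ∀ g : ℕ → Set (X × X), Pairwise (Function.onFun Disjoint g) →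
        (∀ i, MeasurableSet (g i)) → HasSum (fun i => lam.real (g i)) (lam.real (⋃ i, g i)) := by
      intro g hg hgm
      have hne : ∑' i, lam (g i) ≠ ∞ := by
        rw [← measure_iUnion hg hgm]; exact measure_ne_top _ _
      have := ENNReal.hasSum_toReal hne
      rwa [← ENNReal.tsum_toReal_eq fun i => measure_ne_top _ _, ← measure_iUnion hg hgm] at this
    have hs := hsum f hd hfm
    have hfn : ∀ n : ℕ, HasSum (fun i => lam.real (f i ∩ (Prod.map T T)^[n] ⁻¹' (A₂ ×ˢ B₂)))
        (lam.real ((⋃ i, f i) ∩ (Prod.map T T)^[n] ⁻¹' (A₂ ×ˢ B₂))) := by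
      intro n
      rw [Set.iUnion_inter]
      exact hsum _ (fun i j hij => (hd hij).mono Set.inter_subset_left Set.inter_subset_left)
        fun i => (hfm i).inter (hRm n)
    have hN : ∀ N : ℕ, ∑' i, ces (fun n => lam.real (f i ∩ (Prod.map T T)^[n] ⁻¹' (A₂ ×ˢ B₂))) N =
        ces (fun n => lam.real ((⋃ i, f i) ∩ (Prod.map T T)^[n] ⁻¹' (A₂ ×ˢ B₂))) N := by
      intro N
      exact ((hasSum_sum fun n _ => hfn n).mul_left _).tsum_eq
    have hlim := tendsto_tsum_of_dominated_convergence (𝓕 := atTop) (bound := fun i => lam.real (f i))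
      (f := fun N i => ces (fun n => lam.real (f i ∩ (Prod.map T T)^[n] ⁻¹' (A₂ ×ˢ B₂))) N)
      (g := fun i => lam.real (f i) * lam.real (A₂ ×ˢ B₂)) hs.summable ih
      (by
        filter_upwards [eventually_ge_atTop 1] with N hN1 i
        have hN0 : (0 : ℝ) < N := by positivity
        have h0 : 0 ≤ ces (fun n => lam.real (f i ∩ (Prod.map T T)^[n] ⁻¹' (A₂ ×ˢ B₂))) N :=
          mul_nonneg (by positivity) (Finset.sum_nonneg fun n _ => measureReal_nonneg)
        rw [Real.norm_of_nonneg h0, ← ces_const (c := lam.real (f i)) hN1]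
        refine mul_le_mul_of_nonneg_left (Finset.sum_le_sum fun n _ => ?_) (by positivity)
        exact measureReal_mono Set.inter_subset_left)
    rw [(hs.mul_right _).tsum_eq] at hlim
    exact hlim.congr hN

theorem final_ergodic (hT : Ergodic T μ) (h : IsCondSquare (pinskerAlg μ T) μ lam) :
    Ergodic (Prod.map T T) lam := by
  have hmp := hT.toMeasurePreserving
  have hPm : pinskerAlg μ T ≤ m0 := pinskerAlg_le_m0
  have hprob := lam_prob hPm h
  have hS := lam_mp hmp hPm (pinskerAlg_inv hmp) h
  refine ⟨hS, ⟨fun E hE hinv => ?_⟩⟩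
  have hit : ∀ n : ℕ, (Prod.map T T)^[n] ⁻¹' E = E := by
    intro n
    induction n with
    | zero => rfl
    | succ n ih => rw [Function.iterate_succ, Set.preimage_comp, ih, hinv]
  have hrect : ∀ A B : Set X, MeasurableSet A → MeasurableSet B →
      lam.real (E ∩ A ×ˢ B) = lam.real E * lam.real (A ×ˢ B) := by
    intro A B hA hB
    have h1 := all_ces hT h hA hB hE
    have e : ∀ n : ℕ, lam.real (E ∩ (Prod.map T T)^[n] ⁻¹' (A ×ˢ B)) = lam.real (E ∩ A ×ˢ B) := by
      intro n
      conv_lhs => rw [← hit n, ← Set.preimage_inter]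
      exact (hS.iterate n).measureReal_preimage (hE.inter (hA.prod hB)).nullMeasurableSet
    simp_rw [e] at h1
    exact tendsto_nhds_unique (ces_tendsto tendsto_const_nhds) h1
  have hrect' : ∀ A B : Set X, MeasurableSet A → MeasurableSet B →
      lam (E ∩ A ×ˢ B) = lam E * lam (A ×ˢ B) := by
    intro A B hA hB
    rw [← ENNReal.toReal_eq_toReal_iff' (measure_ne_top _ _)
      (ENNReal.mul_ne_top (measure_ne_top _ _) (measure_ne_top _ _)), ENNReal.toReal_mul]
    exact hrect A B hA hB
  have heq : lam.restrict E = lam E • lam := by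
    refine ext_of_generate_finite _ generateFrom_prod.symm isPiSystem_prod ?_ (by simp)
    rintro _ ⟨A, hA, B, hB, rfl⟩
    rw [Measure.restrict_apply (MeasurableSet.prod hA hB), Set.inter_comm, hrect' A B hA hB]
    rfl
  have hsq : lam E = lam E * lam E := by
    have := congrArg (fun ν : Measure (X × X) => ν E) heq
    simpa using this
  rw [eventuallyConst_set']
  rcases eq_or_ne (lam E) 0 with h0 | h0
  · left
    exact ae_eq_empty.2 h0
  · right
    have h1 : lam E = 1 := by
      have h2 : lam E * 1 = lam E * lam E := by rw [mul_one]; exact hsq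
      exact ((ENNReal.mul_right_inj h0 (measure_ne_top _ _)).1 h2).symm
    have hc : lam Eᶜ = 0 := (prob_compl_eq_zero_iff hE).2 h1
    exact ae_eq_univ.2 hc

end Final

/-- For an ergodic invertible measure-preserving system on a Lebesgue
(standard Borel) probability space, the relatively independent square
`λ = μ ⊠_{Π_μ} μ` of `μ` over the Pinsker σ-algebra is ergodic for `T × T`. -/
theorem condSquare_over_pinsker_ergodic
    {X : Type*} [m0 : MeasurableSpace X] [StandardBorelSpace X]
    (μ : Measure X) [IsProbabilityMeasure μ]
    (T : X ≃ᵐ X) (herg : Ergodic (⇑T) μ)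
    (lam : Measure (X × X)) (hlam : IsCondSquare (pinskerAlg μ (⇑T)) μ lam) :
    Ergodic (Prod.map (⇑T) (⇑T)) lam := by
  exact final_ergodic herg hlam
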